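/- arXiv:1109.2934 — 4 statements merged into one kernel-verified Lean document; each statement's English description precedes it below -/
import Mathlib

section
/- Let 𝓕 be a finite family of linear forms, each in at least three variables. Then d_𝓕(ℤ/p) converges to d_𝓕(𝕋) as p → ∞ over primes; that is, for every ε > 0 there exists N such that |d_𝓕(ℤ/p) − d_𝓕(𝕋)| ≤ ε for every prime p ≥ N. -/
open MeasureTheory
noncomputable section

/-- `A` is `L`-free for the form with coefficients `c`. -/
def IsLFree {G : Type*} [AddCommGroup G] {t : ℕ} (c : Fin t → ℤ) (A : Set G) : Prop :=
  ¬∃ x : Fin t → G, (∀ i, x i ∈ A) ∧ ∑ i, c i • x i = 0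

/-- The maximal density of a measurable `𝓕`-free subset, for the family of forms
`𝓕 = (c i)_{i : Fin n}`, where `c i` has `t i` variables. -/
def dF {G : Type*} [AddCommGroup G] [MeasurableSpace G] (μ : Measure G)
    {n : ℕ} {t : Fin n → ℕ} (c : ∀ i, Fin (t i) → ℤ) : ℝ :=
  sSup {r : ℝ | ∃ A : Set G, MeasurableSet A ∧ (∀ i, IsLFree (c i) A) ∧ r = (μ A).toReal}

/-- The maximal density of an `𝓕`-free subset of `ℤ/p`. -/
def dZ (p : ℕ) {n : ℕ} {t : Fin n → ℕ} (c : ∀ i, Fin (t i) → ℤ) : ℝ :=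
  sSup {r : ℝ | ∃ A : Set (ZMod p), (∀ i, IsLFree (c i) A) ∧ r = (Nat.card A : ℝ) / p}

section Cycles

open Finset

variable {G : Type*} [AddCommGroup G] [DecidableEq G]

/-- The number of ways to write `y` as a sum `∑ i, b i` with `b i ∈ B i`. -/
def solCount {m : ℕ} (B : Fin m → Finset G) (y : G) : ℕ :=
  #{b ∈ Fintype.piFinset B | ∑ i, b i = y}

lemma solCount_succ {m : ℕ} (B : Fin (m + 1) → Finset G) (y : G) :
    solCount B y = ∑ b ∈ B 0, solCount (Fin.tail B) (y - b) := by
  unfold solCount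
  rw [← card_sigma]
  refine card_bij' (fun b _ => ⟨b 0, Fin.tail b⟩) (fun q _ => Fin.cons q.1 q.2) ?_ ?_ ?_ ?_
  · intro b hb
    simp only [mem_filter, Fintype.mem_piFinset, mem_sigma] at hb ⊢
    refine ⟨hb.1 0, fun i => hb.1 i.succ, ?_⟩
    rw [← hb.2, Fin.sum_univ_succ]
    simp [Fin.tail]
  · rintro ⟨b, q⟩ hb
    simp only [mem_filter, Fintype.mem_piFinset, mem_sigma] at hb ⊢
    refine ⟨fun i => ?_, ?_⟩
    · refine Fin.cases ?_ (fun j => ?_) i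
      · simpa using hb.1
      · exact hb.2.1 j
    · rw [Fin.sum_univ_succ]
      simp [hb.2.2]
  · intro b _
    simp
  · rintro ⟨b, q⟩ _
    simp

lemma card_low_degree_lt {α β : Type*} {r : α → β → Prop} [∀ a b, Decidable (r a b)]
    {S₀ : Finset α} {T₀ T : Finset β} {σ γ : ℝ} (hσ : 0 < σ)
    (hreg : ∀ S ⊆ S₀, ∀ T ⊆ T₀, σ ≤ #S → σ ≤ #T →
      γ * (#S * #T) ≤ #{q ∈ S ×ˢ T | r q.1 q.2})
    (hT : T ⊆ T₀) (hTσ : σ ≤ #T) :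
    (#{x ∈ S₀ | (#{y ∈ T | r x y} : ℝ) < γ * #T} : ℝ) < σ := by
  by_contra! h
  set S := {x ∈ S₀ | (#{y ∈ T | r x y} : ℝ) < γ * #T} with hS
  have h1 := hreg S (filter_subset _ _) T hT h hTσ
  have h2 : (#{q ∈ S ×ˢ T | r q.1 q.2} : ℝ) = ∑ x ∈ S, (#{y ∈ T | r x y} : ℝ) := by
    simp only [card_filter, sum_product]
    push_cast
    rfl
  have hne : S.Nonempty := by
    rw [← card_pos]
    exact_mod_cast hσ.trans_le h
  have h3 : ∑ x ∈ S, (#{y ∈ T | r x y} : ℝ) < ∑ x ∈ S, γ * #T :=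
    sum_lt_sum_of_nonempty hne fun x hx => (mem_filter.1 hx).2
  rw [sum_const, nsmul_eq_mul] at h3
  nlinarith

lemma sum_translate_le (T B : Finset G) (x : G) {f : G → ℝ} (hf : ∀ y, 0 ≤ f y) :
    ∑ y ∈ T with y - x ∈ B, f y ≤ ∑ b ∈ B, f (x + b) := by
  rw [← sum_image (s := B) (g := fun b => x + b) (f := f) (fun a _ b _ h => by simpa using h)]
  refine sum_le_sum_of_subset_of_nonneg (fun y hy => ?_) fun y _ _ => hf y
  exact mem_image.2 ⟨y - x, (mem_filter.1 hy).2, by abel⟩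

lemma chain_step {m : ℕ} (B : Fin (m + 1) → Finset G) (x : G) {X₀ X₁ Y : Finset G} {σ γ : ℝ}
    (hσ : 0 < σ) (hγ : 0 ≤ γ)
    (hreg : ∀ S ⊆ X₀, ∀ T ⊆ X₁, σ ≤ #S → σ ≤ #T →
      γ * (#S * #T) ≤ #{q ∈ S ×ˢ T | q.2 - q.1 ∈ B 0})
    (hY : Y ⊆ X₀) (hYσ : σ ≤ #Y) :
    ∃ Y' ⊆ X₁, (#X₁ : ℝ) - #Y' ≤ σ ∧
      γ * σ * ∑ y ∈ Y', (solCount (Fin.tail B) (x - y) : ℝ) ≤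
        ∑ y ∈ Y, (solCount B (x - y) : ℝ) := by
  have hlow : (#{y' ∈ X₁ | (#{y ∈ Y | y' - y ∈ B 0} : ℝ) < γ * #Y} : ℝ) < σ := by
    refine card_low_degree_lt (r := fun y' y => y' - y ∈ B 0) (T₀ := X₀) hσ ?_ hY hYσ
    intro S hS T hT hSσ hTσ
    refine (le_of_eq ?_).trans ((hreg T hT S hS hTσ hSσ).trans (le_of_eq ?_))
    · ring
    · norm_cast
      refine card_bij' (fun q _ => q.swap) (fun q _ => q.swap) ?_ ?_ ?_ ?_ <;>
        simp +contextual [and_comm]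
  refine ⟨{y' ∈ X₁ | ¬ (#{y ∈ Y | y' - y ∈ B 0} : ℝ) < γ * #Y}, filter_subset _ _, ?_, ?_⟩
  · have := card_filter_add_card_filter_not (s := X₁)
      (fun y' => (#{y ∈ Y | y' - y ∈ B 0} : ℝ) < γ * #Y)
    have h : (#X₁ : ℝ) = _ := congrArg Nat.cast this.symm
    push_cast at h
    linarith
  set Y' := {y' ∈ X₁ | ¬ (#{y ∈ Y | y' - y ∈ B 0} : ℝ) < γ * #Y} with hY'
  calc γ * σ * ∑ y ∈ Y', (solCount (Fin.tail B) (x - y) : ℝ)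
      ≤ ∑ y' ∈ Y', (#{y ∈ Y | y' - y ∈ B 0} : ℝ) * solCount (Fin.tail B) (x - y') := by
        rw [mul_sum]
        refine sum_le_sum fun y' hy' => ?_
        have := (mem_filter.1 hy').2
        gcongr
        nlinarith
    _ = ∑ y ∈ Y, ∑ y' ∈ Y' with y' - y ∈ B 0, (solCount (Fin.tail B) (x - y') : ℝ) := by
        simp only [card_filter, sum_filter, Nat.cast_sum, sum_mul]
        rw [sum_comm]
        refine sum_congr rfl fun y _ => sum_congr rfl fun y' _ => ?_
        split_ifs <;> simp
    _ ≤ ∑ y ∈ Y, (solCount B (x - y) : ℝ) := by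
        refine sum_le_sum fun y _ => ?_
        rw [solCount_succ]
        push_cast
        refine (sum_translate_le _ _ _ fun _ => by positivity).trans (le_of_eq ?_)
        simp only [sub_sub]

lemma chain_count {m : ℕ} (B X : Fin (m + 2) → Finset G) (x : G) {Y : Finset G} {σ γ : ℝ}
    (hσ : 0 < σ) (hγ : 0 ≤ γ)
    (hreg : ∀ i : Fin (m + 1), ∀ S ⊆ X i.castSucc, ∀ T ⊆ X i.succ, σ ≤ #S → σ ≤ #T →
      γ * (#S * #T) ≤ #{q ∈ S ×ˢ T | q.2 - q.1 ∈ B i.castSucc})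
    (hX : ∀ i, 2 * σ ≤ #(X i))
    (hend : 2 * σ ≤ #{z ∈ X (Fin.last _) | x - z ∈ B (Fin.last _)})
    (hY : Y ⊆ X 0) (hYσ : σ ≤ #Y) :
    γ ^ (m + 1) * σ ^ (m + 2) ≤ ∑ y ∈ Y, (solCount B (x - y) : ℝ) := by
  induction m generalizing Y with
  | zero =>
    obtain ⟨Y', hY', hcard, hle⟩ := chain_step B x hσ hγ (hreg 0) hY hYσ
    refine le_trans ?_ hle
    have hsol : ∀ y ∈ Y', (solCount (Fin.tail B) (x - y) : ℝ) =
        if x - y ∈ B (Fin.last _) then 1 else 0 := by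
      intro y _
      rw [solCount_succ]
      have : ∀ b : G, solCount (Fin.tail (Fin.tail B)) b = if b = 0 then 1 else 0 := by
        intro b
        by_cases hb : b = 0 <;> simp [solCount, hb, eq_comm]
      simp only [this, sub_eq_zero]
      simp [Fin.tail]
    rw [sum_congr rfl hsol, ← sum_filter, sum_const, nsmul_one]
    have : (#{z ∈ X (Fin.last _) | x - z ∈ B (Fin.last _)} : ℝ) ≤
        #{z ∈ Y' | x - z ∈ B (Fin.last _)} + (#(X (Fin.last _)) - #Y') := by
      have h := card_sdiff_add_card_eq_card hY'
      have h' : {z ∈ X (Fin.last _) | x - z ∈ B (Fin.last _)} ⊆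
          {z ∈ Y' | x - z ∈ B (Fin.last _)} ∪ (X (Fin.last _) \ Y') := by
        intro z hz
        rw [mem_filter] at hz
        by_cases hzY : z ∈ Y'
        · exact mem_union_left _ (mem_filter.2 ⟨hzY, hz.2⟩)
        · exact mem_union_right _ (mem_sdiff.2 ⟨hz.1, hzY⟩)
      have h'' := (card_le_card h').trans (card_union_le _ _)
      have h3 : (#(X (Fin.last 1)) : ℝ) = _ := congrArg Nat.cast h.symm
      have h4 : (#{z ∈ X (Fin.last _) | x - z ∈ B (Fin.last _)} : ℝ) ≤ _ := Nat.cast_le.2 h''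
      push_cast at h3 h4
      simp only [Fin.succ_zero_eq_one, Fin.isValue, Fin.reduceLast, Nat.reduceAdd] at *
      linarith
    have h2 : σ ≤ #{z ∈ Y' | x - z ∈ B (Fin.last _)} := by
      have : (#(X (Fin.last 1)) : ℝ) - #Y' ≤ σ := hcard
      linarith
    calc γ ^ (0 + 1) * σ ^ (0 + 2) = γ * σ * σ := by ring
      _ ≤ _ := by gcongr
  | succ m ih =>
    obtain ⟨Y', hY', hcard, hle⟩ := chain_step B x hσ hγ (hreg 0) hY hYσ
    have hY'σ : σ ≤ #Y' := by
      have := hX (Fin.succ 0)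
      linarith
    have := ih (Fin.tail B) (Fin.tail X) (fun i => hreg i.succ) (fun i => hX i.succ) hend hY' hY'σ
    calc γ ^ (m + 1 + 1) * σ ^ (m + 1 + 2) = γ * σ * (γ ^ (m + 1) * σ ^ (m + 2)) := by ring
      _ ≤ _ := by gcongr
      _ ≤ _ := hle

lemma cycle_count {m : ℕ} (B X : Fin (m + 3) → Finset G) {σ γ : ℝ} (hσ : 0 < σ) (hγ : 0 ≤ γ)
    (hreg : ∀ i, ∀ S ⊆ X i, ∀ T ⊆ X (i + 1), σ ≤ #S → σ ≤ #T →
      γ * (#S * #T) ≤ #{q ∈ S ×ˢ T | q.2 - q.1 ∈ B i})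
    (hX : ∀ i, 2 * σ ≤ #(X i)) (hX' : ∀ i, 2 * σ ≤ γ * #(X i)) :
    γ ^ (m + 1) * σ ^ (m + 2) ≤ solCount B 0 := by
  have hXσ : ∀ i, σ ≤ #(X i) := fun i => by linarith [hX i]
  have h1 : (#{x ∈ X 0 | (#{y ∈ X 1 | y - x ∈ B 0} : ℝ) < γ * #(X 1)} : ℝ) < σ := by
    refine card_low_degree_lt (r := fun x y => y - x ∈ B 0) (T₀ := X 1) hσ ?_ subset_rfl (hXσ 1)
    simpa using hreg 0
  have h2 : (#{x ∈ X 0 | (#{z ∈ X (Fin.last _) | x - z ∈ B (Fin.last _)} : ℝ) <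
      γ * #(X (Fin.last _))} : ℝ) < σ := by
    refine card_low_degree_lt (r := fun x z => x - z ∈ B (Fin.last _)) (T₀ := X (Fin.last _)) hσ
      ?_ subset_rfl (hXσ _)
    intro S hS T hT hSσ hTσ
    refine (le_of_eq ?_).trans ((hreg (Fin.last _) T hT S (by simpa using hS) hTσ hSσ).trans
      (le_of_eq ?_))
    · ring
    · norm_cast
      refine card_bij' (fun q _ => q.swap) (fun q _ => q.swap) ?_ ?_ ?_ ?_ <;>
        simp +contextual [and_comm]
  obtain ⟨x, hx, hx1, hx2⟩ : ∃ x ∈ X 0, γ * #(X 1) ≤ (#{y ∈ X 1 | y - x ∈ B 0} : ℝ) ∧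
      γ * #(X (Fin.last _)) ≤ (#{z ∈ X (Fin.last _) | x - z ∈ B (Fin.last _)} : ℝ) := by
    by_contra! hcon
    have hsub : X 0 ⊆ {x ∈ X 0 | (#{y ∈ X 1 | y - x ∈ B 0} : ℝ) < γ * #(X 1)} ∪
        {x ∈ X 0 | (#{z ∈ X (Fin.last _) | x - z ∈ B (Fin.last _)} : ℝ) <
          γ * #(X (Fin.last _))} := by
      intro x hx
      rw [mem_union, mem_filter, mem_filter]
      by_cases h : (#{y ∈ X 1 | y - x ∈ B 0} : ℝ) < γ * #(X 1)
      · exact Or.inl ⟨hx, h⟩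
      · exact Or.inr ⟨hx, hcon x hx (not_lt.1 h)⟩
    have := (card_le_card hsub).trans (card_union_le _ _)
    have h3 : (#(X 0) : ℝ) ≤ _ := Nat.cast_le.2 this
    push_cast at h3
    linarith [hX 0]
  have key := chain_count (Fin.tail B) (Fin.tail X) x (Y := {y ∈ X 1 | y - x ∈ B 0}) hσ hγ
    (fun i S hS T hT => hreg i.castSucc.succ S hS T (by
      have : (i.castSucc.succ + 1 : Fin (m + 3)) = i.succ.succ := by
        ext
        simp [Fin.val_add, Nat.mod_eq_of_lt]
        lia
      rw [this]; exact hT)) (fun i => hX i.succ)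
    ((hX' _).trans hx2) (filter_subset _ _) (by linarith [hX' 1])
  refine key.trans ?_
  rw [solCount_succ]
  push_cast
  refine (sum_translate_le _ _ _ fun _ => by positivity).trans (le_of_eq ?_)
  simp

end Cycles

section Removal

open Finset SimpleGraph

variable {G : Type*} [AddCommGroup G]

/-- The cyclically `(m + 3)`-partite graph on copies of `G` in which `(i, x)` is joined to
`(i + 1, y)` when `y - x ∈ B i`. -/
def cyclicGraph {m : ℕ} (B : Fin (m + 3) → Finset G) : SimpleGraph (Fin (m + 3) × G) :=
  SimpleGraph.fromRel fun u v => v.1 = u.1 + 1 ∧ v.2 - u.2 ∈ B u.1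

lemma cyclicGraph_adj {m : ℕ} (B : Fin (m + 3) → Finset G) (i : Fin (m + 3)) (x y : G) :
    (cyclicGraph B).Adj (i, x) (i + 1, y) ↔ y - x ∈ B i := by
  have h1 : (i : Fin (m + 3)) ≠ i + 1 := by simp
  have h2 : (i : Fin (m + 3)) ≠ i + 1 + 1 := by
    rw [add_assoc, ne_eq, left_eq_add]
    intro h
    have := congrArg Fin.val h
    simp [Fin.val_add] at this
    rw [Nat.mod_eq_of_lt (by lia)] at this
    lia
  simp [cyclicGraph, h1, h2]

lemma exists_walk {m : ℕ} (b : Fin (m + 3) → G) (hb : ∑ i, b i = 0) :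
    ∃ s : Fin (m + 3) → G, ∀ i, s (i + 1) = s i + b i := by
  refine ⟨fun i => Fin.partialSum b i.castSucc, fun i => ?_⟩
  rw [← Fin.partialSum_succ]
  obtain ⟨j, rfl⟩ | rfl := i.eq_castSucc_or_eq_last
  · have h : (j.castSucc + 1).castSucc = j.castSucc.succ := by
      ext
      simp
    simp only [h]
  · have h : Fin.partialSum b (Fin.last (m + 2)).succ = ∑ i, b i := by
      rw [← List.sum_ofFn, Fin.partialSum, List.take_of_length_le (by simp)]
    rw [h, hb]
    simp

variable [Fintype G] [DecidableEq G]

lemma exists_removal_of_bad {m : ℕ} (B : Fin (m + 3) → Finset G)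
    (bad : Finset ((Fin (m + 3) × G) × (Fin (m + 3) × G))) {ε : ℝ}
    (hbad : (#bad : ℝ) * (m + 3) ≤ ε * (Fintype.card G : ℝ) ^ 2) :
    ∃ R : Fin (m + 3) → Finset G, (∀ i, (#(R i) : ℝ) ≤ ε * Fintype.card G) ∧
      ∀ b : Fin (m + 3) → G, (∀ i, b i ∈ B i ∧ b i ∉ R i) → ∑ i, b i = 0 →
        ∃ x : Fin (m + 3) → G, ∀ i, x (i + 1) - x i ∈ B i ∧
          ((i, x i), (i + 1, x (i + 1))) ∉ bad := by
  have hn : (0 : ℝ) < Fintype.card G := by exact_mod_cast Fintype.card_pos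
  refine ⟨fun i => {b ∈ B i | Fintype.card G ≤
    (m + 3) * #{x : G | ((i, x), (i + 1, x + b)) ∈ bad}}, fun i => ?_, fun b hb hsum => ?_⟩
  · set R := {b ∈ B i | Fintype.card G ≤ (m + 3) * #{x : G | ((i, x), (i + 1, x + b)) ∈ bad}}
    have h1 : #R * Fintype.card G ≤ (m + 3) * #bad := by
      calc #R * Fintype.card G = ∑ b ∈ R, Fintype.card G := by simp
        _ ≤ ∑ b ∈ R, (m + 3) * #{x : G | ((i, x), (i + 1, x + b)) ∈ bad} :=
          sum_le_sum fun b hb => (mem_filter.1 hb).2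
        _ = (m + 3) * #(R.sigma fun b => {x : G | ((i, x), (i + 1, x + b)) ∈ bad}) := by
          rw [card_sigma, mul_sum]
        _ ≤ (m + 3) * #bad := by
          refine Nat.mul_le_mul_left _ (card_le_card_of_injOn
            (fun q => ((i, q.2), (i + 1, q.2 + q.1))) ?_ ?_)
          · intro q hq
            simp only [coe_sigma, Set.mem_sigma_iff, mem_coe, mem_filter] at hq
            exact hq.2.2
          · rintro ⟨b, x⟩ _ ⟨b', x'⟩ _ h
            simp only [Prod.mk.injEq, true_and] at h
            obtain ⟨rfl, h⟩ := h
            simp at h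
            simp [h]
    have h2 : (#R : ℝ) * Fintype.card G ≤ (m + 3) * #bad := by exact_mod_cast h1
    refine le_of_mul_le_mul_right ?_ hn
    nlinarith
  · obtain ⟨s, hs⟩ := exists_walk b hsum
    have hlt : ∀ i, (m + 3) * #{x : G | ((i, x), (i + 1, x + b i)) ∈ bad} < Fintype.card G := by
      intro i
      have := (hb i).2
      rw [mem_filter, not_and, not_le] at this
      exact this (hb i).1
    have hshift : ∀ i, #{x : G | ((i, x + s i), (i + 1, x + s (i + 1))) ∈ bad} =
        #{x : G | ((i, x), (i + 1, x + b i)) ∈ bad} := by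
      intro i
      refine card_bij' (fun x _ => x + s i) (fun x _ => x - s i) ?_ ?_ ?_ ?_
      · intro x hx
        simpa [hs, add_assoc] using hx
      · intro x hx
        have : x - s i + (s i + b i) = x + b i := by abel
        simpa [hs, this] using hx
      · simp
      · simp
    obtain ⟨x, hx⟩ : ∃ x : G, ∀ i, ((i, x + s i), (i + 1, x + s (i + 1))) ∉ bad := by
      by_contra! hcon
      have h1 : Fintype.card G ≤
          ∑ i, #{x : G | ((i, x + s i), (i + 1, x + s (i + 1))) ∈ bad} := by
        rw [← card_univ]
        refine (card_le_card fun x _ => ?_).trans card_biUnion_le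
        obtain ⟨i, hi⟩ := hcon x
        exact mem_biUnion.2 ⟨i, mem_univ _, mem_filter.2 ⟨mem_univ _, hi⟩⟩
      have h2 : ∑ i : Fin (m + 3), (m + 3) *
          #{x : G | ((i, x + s i), (i + 1, x + s (i + 1))) ∈ bad} <
          ∑ i : Fin (m + 3), Fintype.card G := by
        refine sum_lt_sum_of_nonempty univ_nonempty fun i _ => ?_
        rw [hshift]
        exact hlt i
      rw [← mul_sum] at h2
      simp only [sum_const, card_univ, Fintype.card_fin, smul_eq_mul] at h2
      exact absurd (Nat.mul_le_mul_left (m + 3) h1) (not_le.2 h2)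
    refine ⟨fun i => x + s i, fun i => ⟨?_, hx i⟩⟩
    simp only [hs]
    convert (hb i).1 using 1
    abel

/-- A pair of vertices of the cyclic graph is good for a partition if their parts form a dense
uniform pair, and both parts contain many vertices of the respective colour. -/
def IsGoodPair {m : ℕ} (Γ : SimpleGraph (Fin (m + 3) × G)) [DecidableRel Γ.Adj]
    (P : Finpartition (univ : Finset (Fin (m + 3) × G))) (η d κ : ℝ)
    (u v : Fin (m + 3) × G) : Prop :=
  ∃ U ∈ P.parts, ∃ V ∈ P.parts, u ∈ U ∧ v ∈ V ∧ Γ.IsUniform η U V ∧ d ≤ Γ.edgeDensity U V ∧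
    κ * #U ≤ #{w ∈ U | w.1 = u.1} ∧ κ * #V ≤ #{w ∈ V | w.1 = v.1}

omit [AddCommGroup G] in
open Classical in
lemma card_small_le {m : ℕ} (P : Finpartition (univ : Finset (Fin (m + 3) × G))) {κ : ℝ}
    (hκ : 0 ≤ κ) :
    (#{u : Fin (m + 3) × G | ∃ U ∈ P.parts, u ∈ U ∧ (#{w ∈ U | w.1 = u.1} : ℝ) < κ * #U} : ℝ) ≤
      (m + 3) * κ * Fintype.card (Fin (m + 3) × G) := by
  have hsub : ({u : Fin (m + 3) × G | ∃ U ∈ P.parts, u ∈ U ∧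
      (#{w ∈ U | w.1 = u.1} : ℝ) < κ * #U} : Finset _) ⊆
      P.parts.biUnion fun U => univ.biUnion fun i : Fin (m + 3) =>
        if (#{w ∈ U | w.1 = i} : ℝ) < κ * #U then {w ∈ U | w.1 = i} else ∅ := by
    intro u hu
    obtain ⟨U, hU, huU, hlt⟩ := (mem_filter.1 hu).2
    simp only [mem_biUnion, mem_univ, true_and]
    refine ⟨U, hU, u.1, ?_⟩
    rw [if_pos hlt]
    exact mem_filter.2 ⟨huU, rfl⟩
  have h1 := (card_le_card hsub).trans (card_biUnion_le.trans
    (sum_le_sum fun U _ => card_biUnion_le))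
  refine (Nat.cast_le.2 h1).trans ?_
  push_cast
  calc ∑ U ∈ P.parts, ∑ i : Fin (m + 3),
        (#(if (#{w ∈ U | w.1 = i} : ℝ) < κ * #U then {w ∈ U | w.1 = i} else ∅) : ℝ)
      ≤ ∑ U ∈ P.parts, ∑ i : Fin (m + 3), κ * #U := by
        refine sum_le_sum fun U _ => sum_le_sum fun i _ => ?_
        split_ifs with h
        · exact h.le
        · simp only [card_empty, Nat.cast_zero]
          positivity
    _ = (m + 3) * κ * ∑ U ∈ P.parts, (#U : ℝ) := by
        simp [mul_sum, mul_assoc]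
    _ = _ := by
        rw [← Nat.cast_sum, P.sum_card_parts, card_univ]

open Classical in
lemma card_bad_le {m : ℕ} (Γ : SimpleGraph (Fin (m + 3) × G)) [DecidableRel Γ.Adj]
    (P : Finpartition (univ : Finset (Fin (m + 3) × G))) {η d κ e : ℝ} (hη : 0 < η) (hd : 0 ≤ d)
    (hκ : 0 ≤ κ) (he : 0 < e) (hP : P.IsEquipartition) (hPη : P.IsUniform Γ η) (hPe : 4 / e ≤ #P.parts) :
    (#{q : (Fin (m + 3) × G) × (Fin (m + 3) × G) |
      Γ.Adj q.1 q.2 ∧ ¬ IsGoodPair Γ P η d κ q.1 q.2} : ℝ) ≤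
      (4 * η + e / 2 + 4 * d + 2 * ((m + 3) * κ)) *
        (Fintype.card (Fin (m + 3) × G) : ℝ) ^ 2 := by
  set small : Finset (Fin (m + 3) × G) :=
    {u | ∃ U ∈ P.parts, u ∈ U ∧ (#{w ∈ U | w.1 = u.1} : ℝ) < κ * #U} with hsmall
  have hs := card_small_le P hκ
  rw [← hsmall] at hs
  have hsub : ({q : (Fin (m + 3) × G) × (Fin (m + 3) × G) |
      Γ.Adj q.1 q.2 ∧ ¬ IsGoodPair Γ P η d κ q.1 q.2} : Finset _) ⊆
      ((P.nonUniforms Γ η).biUnion (fun (U, V) ↦ U ×ˢ V) ∪ P.parts.biUnion offDiag ∪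
        (P.sparsePairs Γ d).biUnion fun (U, V) ↦ Γ.interedges U V) ∪
      (small ×ˢ univ ∪ univ ×ˢ small) := by
    rintro ⟨x, y⟩ hxy
    obtain ⟨hadj, hgood⟩ := (mem_filter.1 hxy).2
    obtain ⟨U, hU, hx⟩ := P.exists_mem (mem_univ x)
    obtain ⟨V, hV, hy⟩ := P.exists_mem (mem_univ y)
    simp only [mem_biUnion, mem_union, mem_product, Prod.exists, mem_offDiag, mem_univ,
      P.mk_mem_nonUniforms, Finpartition.mk_mem_sparsePairs, mem_interedges_iff, and_true, true_and]
    by_cases hxs : x ∈ small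
    · exact Or.inr (Or.inl hxs)
    by_cases hys : y ∈ small
    · exact Or.inr (Or.inr hys)
    left
    obtain rfl | hUV := eq_or_ne U V
    · exact Or.inl (Or.inr ⟨U, hU, hx, hy, Γ.ne_of_adj hadj⟩)
    by_cases h₂ : Γ.IsUniform η U V
    · by_cases h₃ : d ≤ Γ.edgeDensity U V
      · refine absurd ⟨U, hU, V, hV, hx, hy, h₂, h₃, ?_, ?_⟩ hgood
        · by_contra! h
          exact hxs (mem_filter.2 ⟨mem_univ _, U, hU, hx, h⟩)
        · by_contra! h
          exact hys (mem_filter.2 ⟨mem_univ _, V, hV, hy, h⟩)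
      · exact Or.inr ⟨U, V, ⟨hU, hV, hUV, not_le.1 h₃⟩, hx, hy, hadj⟩
    · exact Or.inl (Or.inl ⟨U, V, ⟨hU, hV, hUV, h₂⟩, hx, hy⟩)
  have h1 := hP.sum_nonUniforms_lt univ_nonempty hη hPη
  have h2 := hP.card_biUnion_offDiag_le he hPe
  have h3 := hP.card_interedges_sparsePairs_le (G := Γ) hd
  have h4 := (card_le_card hsub).trans ((card_union_le _ _).trans (Nat.add_le_add
    ((card_union_le _ _).trans (Nat.add_le_add_right (card_union_le _ _) _)) (card_union_le _ _)))
  rw [card_product, card_product, card_univ] at h4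
  refine (Nat.cast_le.2 h4).trans ?_
  push_cast
  rw [card_univ] at h1 h2 h3
  nlinarith [Nat.cast_nonneg (α := ℝ) (Fintype.card (Fin (m + 3) × G))]

end Removal

section RemovalLemma

open Finset SimpleGraph

variable {G : Type*} [AddCommGroup G] [Fintype G] [DecidableEq G]

open Classical in
lemma le_solCount_of_isGoodPair {m : ℕ} (B : Fin (m + 3) → Finset G)
    (P : Finpartition (univ : Finset (Fin (m + 3) × G))) (hP : P.IsEquipartition)
    {d κ : ℝ} (hd : 0 < d) (hd1 : d ≤ 1) (hκ : 0 < κ) (hκ1 : κ ≤ 1) (x : Fin (m + 3) → G)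
    (hx : ∀ i, IsGoodPair (cyclicGraph B) P (d * κ / 16) d κ (i, x i) (i + 1, x (i + 1))) :
    (d / 2) ^ (m + 1) * (d * κ / 16 * (Fintype.card G / #P.parts)) ^ (m + 2) ≤ solCount B 0 := by
  set η := d * κ / 16 with hη
  have hη0 : 0 < η := by positivity
  set M : ℕ := #(univ : Finset (Fin (m + 3) × G)) / #P.parts + 1 with hM
  have hparts : 0 < #P.parts := by
    obtain ⟨U, hU, -⟩ := hx 0
    exact card_pos.2 ⟨U, hU⟩
  have havg : 1 ≤ #(univ : Finset (Fin (m + 3) × G)) / #P.parts :=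
    (Nat.one_le_div_iff hparts).2 P.card_parts_le_card
  have hUle : ∀ U ∈ P.parts, (#U : ℝ) ≤ M := fun U hU => by
    exact_mod_cast hP.card_part_le_average_add_one hU
  have hleU : ∀ U ∈ P.parts, (M : ℝ) ≤ 2 * #U := fun U hU => by
    have := hP.average_le_card_part hU
    have h : M ≤ 2 * #U := by lia
    exact_mod_cast h
  have hMpos : (0 : ℝ) < M := by positivity
  have hMge : (Fintype.card G / #P.parts : ℝ) ≤ M := by
    rw [div_le_iff₀ (by exact_mod_cast hparts)]
    have h1 : #(univ : Finset (Fin (m + 3) × G)) < #P.parts * M := Nat.lt_mul_div_succ _ hparts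
    have h2 : Fintype.card G ≤ #(univ : Finset (Fin (m + 3) × G)) := by
      rw [card_univ, Fintype.card_prod, Fintype.card_fin]
      exact Nat.le_mul_of_pos_left _ (by lia)
    have h3 : Fintype.card G ≤ M * #P.parts := by
      rw [mul_comm]
      lia
    exact_mod_cast h3
  set X : Fin (m + 3) → Finset G := fun i => {y | (i, y) ∈ P.part (i, x i)} with hX
  have hXmap : ∀ i, ∀ U ∈ P.parts, (i, x i) ∈ U → U = P.part (i, x i) ∧
      #{w ∈ U | w.1 = i} = #(X i) := by
    intro i U hU hiU
    have hUP : P.part (i, x i) = U := P.part_eq_of_mem hU hiU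
    refine ⟨hUP.symm, ?_⟩
    refine card_bij' (fun w _ => w.2) (fun y _ => (i, y)) ?_ ?_ ?_ ?_
    · rintro ⟨j, y⟩ h
      simp only [mem_filter] at h
      obtain ⟨h, rfl⟩ := h
      simpa [hX, hUP] using h
    · intro y h
      simpa [hX, hUP] using h
    · rintro ⟨j, y⟩ h
      simp only [mem_filter] at h
      simp [h.2]
    · simp
  have hpart : ∀ i, P.part (i, x i) ∈ P.parts := fun i => P.part_mem.2 (mem_univ _)
  have hXge : ∀ i, κ * M / 2 ≤ #(X i) := by
    intro i
    obtain ⟨U, hU, V, -, hxU, -, -, -, hκU, -⟩ := hx i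
    rw [(hXmap i U hU hxU).2] at hκU
    have := hleU U hU
    nlinarith
  have hσ : 0 < η * M := by positivity
  refine le_trans ?_ (cycle_count B X (σ := η * M) (γ := d / 2) hσ (by positivity) ?_ ?_ ?_)
  · gcongr
  · intro i S hS T hT hSσ hTσ
    obtain ⟨U, hU, V, hV, hxU, hxV, huni, hdens, -, -⟩ := hx i
    obtain rfl := (hXmap i U hU hxU).1
    obtain rfl := (hXmap (i + 1) V hV hxV).1
    set S' : Finset (Fin (m + 3) × G) := S.map (Function.Embedding.sectR i G) with hS'
    set T' : Finset (Fin (m + 3) × G) := T.map (Function.Embedding.sectR (i + 1) G) with hT'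
    have hS'sub : S' ⊆ P.part (i, x i) := by
      intro w hw
      obtain ⟨y, hy, rfl⟩ := mem_map.1 hw
      simpa [hX] using hS hy
    have hT'sub : T' ⊆ P.part (i + 1, x (i + 1)) := by
      intro w hw
      obtain ⟨y, hy, rfl⟩ := mem_map.1 hw
      simpa [hX] using hT hy
    have h1 := huni hS'sub hT'sub (by
      rw [hS', card_map]
      refine le_trans ?_ hSσ
      rw [mul_comm]
      exact mul_le_mul_of_nonneg_left (hUle _ hU) hη0.le) (by
      rw [hT', card_map]
      refine le_trans ?_ hTσ
      rw [mul_comm]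
      exact mul_le_mul_of_nonneg_left (hUle _ hV) hη0.le)
    have h2 : d / 2 ≤ ((cyclicGraph B).edgeDensity S' T' : ℝ) := by
      have := (abs_lt.1 h1).1
      have : η ≤ d / 2 := by
        rw [hη]
        nlinarith
      linarith
    rw [← card_interedges_div_card] at h2
    push_cast at h2
    rw [le_div_iff₀ (by
      rw [hS', hT', card_map, card_map]
      exact mul_pos (hσ.trans_le hSσ) (hσ.trans_le hTσ))] at h2
    rw [hS', hT', card_map, card_map] at h2
    refine h2.trans ?_
    norm_cast
    refine card_le_card_of_injOn (fun w => (w.1.2, w.2.2)) ?_ ?_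
    · rintro ⟨w, z⟩ h
      rw [mem_coe, mem_interedges_iff, mem_map, mem_map] at h
      obtain ⟨⟨y, hy, rfl⟩, ⟨y', hy', rfl⟩, hadj⟩ := h
      simp only [Function.Embedding.sectR_apply, cyclicGraph_adj] at hadj
      simp [hy, hy', hadj]
    · rintro ⟨w, z⟩ h ⟨w', z'⟩ h' heq
      rw [mem_coe, mem_interedges_iff, mem_map, mem_map] at h h'
      obtain ⟨⟨y, hy, rfl⟩, ⟨y', hy', rfl⟩, -⟩ := h
      obtain ⟨⟨z, hz, rfl⟩, ⟨z', hz', rfl⟩, -⟩ := h'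
      simpa using heq
  · intro i
    have := hXge i
    rw [hη]
    nlinarith [mul_pos hκ hMpos]
  · intro i
    have := mul_le_mul_of_nonneg_left (hXge i) (show 0 ≤ d / 2 by positivity)
    rw [hη]
    nlinarith [mul_pos (mul_pos hd hκ) hMpos]

/-- Removal lemma for the equation `∑ i, b i = 0` in finite abelian groups. -/
theorem exists_removal (m : ℕ) {ε : ℝ} (hε : 0 < ε) :
    ∃ δ > 0, ∃ n₀ : ℕ, ∀ (G : Type) [AddCommGroup G] [Fintype G] [DecidableEq G],
      n₀ ≤ Fintype.card G → ∀ B : Fin (m + 3) → Finset G,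
      (solCount B 0 : ℝ) < δ * (Fintype.card G : ℝ) ^ (m + 2) →
      ∃ R : Fin (m + 3) → Finset G, (∀ i, (#(R i) : ℝ) ≤ ε * Fintype.card G) ∧
        ∀ b : Fin (m + 3) → G, (∀ i, b i ∈ B i ∧ b i ∉ R i) → ∑ i, b i ≠ 0 := by
  classical
  wlog hε1 : ε ≤ 1 generalizing ε
  · obtain ⟨δ, hδ, n₀, h⟩ := this one_pos le_rfl
    refine ⟨δ, hδ, n₀, fun G _ _ _ hn B hB => ?_⟩
    obtain ⟨R, hR, hR'⟩ := h G hn B hB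
    refine ⟨R, fun i => (hR i).trans ?_, hR'⟩
    gcongr
    exact (not_le.1 hε1).le
  set t : ℝ := m + 3 with ht
  have ht3 : 3 ≤ t := by
    rw [ht]
    linarith [Nat.cast_nonneg (α := ℝ) m]
  set d := ε / (16 * t ^ 3) with hd
  set e := ε / (2 * t ^ 3) with he
  set κ := ε / (8 * t ^ 4) with hκ
  have ht1 : ∀ k : ℕ, 1 ≤ t ^ k := fun k => one_le_pow₀ (by linarith)
  have hd0 : 0 < d := by positivity
  have he0 : 0 < e := by positivity
  have hκ0 : 0 < κ := by positivity
  have hd1 : d ≤ 1 := by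
    rw [hd, div_le_one (by positivity)]
    linarith [ht1 3]
  have hκ1 : κ ≤ 1 := by
    rw [hκ, div_le_one (by positivity)]
    linarith [ht1 4]
  set l := ⌈4 / e⌉₊ with hl
  set M := SzemerediRegularity.bound (d * κ / 16) l with hM
  have hη : 0 < d * κ / 16 := by positivity
  have hM0 : 0 < M := SzemerediRegularity.bound_pos _ _
  refine ⟨(d / 2) ^ (m + 1) * (d * κ / 16 / M) ^ (m + 2), by positivity, l,
    fun G _ _ _ hn B hB => ?_⟩
  have hcard : Fintype.card (Fin (m + 3) × G) = (m + 3) * Fintype.card G := by simp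
  obtain ⟨P, hP, hlP, hPM, hPη⟩ := szemeredi_regularity (cyclicGraph B) hη (l := l)
    (hn.trans (by rw [hcard]; exact Nat.le_mul_of_pos_left _ (by lia)))
  have hl4 : 4 / e ≤ #P.parts := (Nat.le_ceil _).trans (by exact_mod_cast hlP)
  have hbad := card_bad_le (cyclicGraph B) P hη hd0.le hκ0.le he0 hP hPη hl4
  set bad : Finset ((Fin (m + 3) × G) × (Fin (m + 3) × G)) := {q | (cyclicGraph B).Adj q.1 q.2 ∧
    ¬ IsGoodPair (cyclicGraph B) P (d * κ / 16) d κ q.1 q.2} with hbad_def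
  obtain ⟨R, hR, hR'⟩ := exists_removal_of_bad B bad (ε := ε) (by
    refine (mul_le_mul_of_nonneg_right hbad (by positivity)).trans ?_
    rw [hcard]
    push_cast
    rw [← ht]
    have h1 : 4 * (d * κ / 16) ≤ d / 4 := by nlinarith
    have h2 : t ^ 3 * d = ε / 16 := by rw [hd]; field_simp
    have h3 : t ^ 3 * e = ε / 2 := by rw [he]; field_simp
    have h4 : t ^ 3 * (t * κ) = ε / 8 := by rw [hκ]; field_simp
    have h5 : (4 * (d * κ / 16) + e / 2 + 4 * d + 2 * (t * κ)) * t ^ 3 ≤ ε := by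
      have := mul_le_mul_of_nonneg_right h1 (show 0 ≤ t ^ 3 by positivity)
      linarith
    calc _ = ((4 * (d * κ / 16) + e / 2 + 4 * d + 2 * (t * κ)) * t ^ 3) *
          (Fintype.card G : ℝ) ^ 2 := by ring
      _ ≤ _ := by gcongr)
  refine ⟨R, hR, fun b hb hsum => ?_⟩
  obtain ⟨x, hx⟩ := hR' b hb hsum
  have hgood := le_solCount_of_isGoodPair B P hP hd0 hd1 hκ0 hκ1 x fun i => by
    obtain ⟨hadj, hnb⟩ := hx i
    by_contra hng
    exact hnb (mem_filter.2 ⟨mem_univ _, (cyclicGraph_adj B i _ _).2 hadj, hng⟩)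
  have hparts : 0 < #P.parts := by
    have : (0 : ℝ) < #P.parts := lt_of_lt_of_le (by positivity) hl4
    exact_mod_cast this
  refine absurd (hgood.trans_lt hB) (not_lt.2 ?_)
  calc (d / 2) ^ (m + 1) * (d * κ / 16 / M) ^ (m + 2) * (Fintype.card G : ℝ) ^ (m + 2)
      = (d / 2) ^ (m + 1) * (d * κ / 16 * (Fintype.card G / M)) ^ (m + 2) := by
        rw [mul_assoc, ← mul_pow]
        congr 2
        ring
    _ ≤ _ := by gcongr

end RemovalLemma

section Fourier

open Finset

variable {p : ℕ} [Fact p.Prime]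

/-- The Fourier transform on `ZMod p`. -/
def fourierZ (f : ZMod p → ℝ) (r : ZMod p) : ℂ := ∑ x, (f x : ℂ) * ZMod.stdAddChar (r * x)

/-- The solutions in `ZMod p` of `∑ i, c i * x i = 0` counted with weight `∏ i, f (x i)`. -/
def weightedCount {t : ℕ} (c : Fin t → ZMod p) (f : ZMod p → ℝ) : ℝ :=
  ∑ x : Fin t → ZMod p with ∑ i, c i * x i = 0, ∏ i, f (x i)

lemma sum_stdAddChar_mul (b : ZMod p) :
    ∑ r : ZMod p, ZMod.stdAddChar (r * b) = if b = 0 then (p : ℂ) else 0 := by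
  rw [AddChar.sum_mulShift b (ZMod.isPrimitive_stdAddChar p), ZMod.card]
  push_cast
  rfl

lemma norm_stdAddChar (x : ZMod p) : ‖ZMod.stdAddChar x‖ = 1 := by
  rw [ZMod.stdAddChar_apply, Circle.norm_coe]

lemma stdAddChar_sum {ι : Type*} (s : Finset ι) (x : ι → ZMod p) :
    ZMod.stdAddChar (∑ i ∈ s, x i) = ∏ i ∈ s, ZMod.stdAddChar (x i) := by
  classical
  induction s using Finset.induction_on with
  | empty => simp
  | insert a s ha ih => rw [sum_insert ha, prod_insert ha, AddChar.map_add_eq_mul, ih]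

lemma sum_prod_fourierZ {t : ℕ} (c : Fin t → ZMod p) (f : ZMod p → ℝ) :
    ∑ r, ∏ i, fourierZ f (r * c i) = p * (weightedCount c f : ℂ) := by
  simp only [fourierZ, prod_univ_sum, Fintype.piFinset_univ]
  rw [sum_comm]
  have h : ∀ x : Fin t → ZMod p, ∑ r : ZMod p,
      ∏ i, ((f (x i) : ℂ) * ZMod.stdAddChar (r * c i * x i)) =
      if ∑ i, c i * x i = 0 then p * ∏ i, (f (x i) : ℂ) else 0 := by
    intro x
    have h1 : ∀ r : ZMod p, ∏ i, ((f (x i) : ℂ) * ZMod.stdAddChar (r * c i * x i)) =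
        (∏ i, (f (x i) : ℂ)) * ZMod.stdAddChar (r * ∑ i, c i * x i) := by
      intro r
      rw [prod_mul_distrib, mul_sum, stdAddChar_sum]
      simp only [mul_assoc]
    simp only [h1]
    rw [← mul_sum, sum_stdAddChar_mul]
    split_ifs <;> ring
  rw [sum_congr rfl fun x _ => h x, ← sum_filter, weightedCount, ← mul_sum]
  push_cast
  rfl

lemma sum_norm_fourierZ_sq (f : ZMod p → ℝ) :
    ∑ r, ‖fourierZ f r‖ ^ 2 = p * ∑ x, f x ^ 2 := by
  have h : ∀ r, ((‖fourierZ f r‖ ^ 2 : ℝ) : ℂ) =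
      ∑ x, ∑ y, (f x : ℂ) * f y * ZMod.stdAddChar (r * (x - y)) := by
    intro r
    push_cast
    rw [← Complex.mul_conj', fourierZ, map_sum, sum_mul_sum]
    refine sum_congr rfl fun x _ => sum_congr rfl fun y _ => ?_
    rw [map_mul (starRingEnd ℂ), Complex.conj_ofReal, ← AddChar.map_neg_eq_conj, mul_sub,
      sub_eq_add_neg, AddChar.map_add_eq_mul]
    ring
  apply Complex.ofReal_injective
  push_cast at h ⊢
  simp only [h]
  rw [sum_comm, mul_sum]
  refine sum_congr rfl fun x _ => ?_
  rw [sum_comm]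
  simp only [← mul_sum, sum_stdAddChar_mul, sub_eq_zero, mul_ite, mul_zero]
  rw [sum_ite_eq, if_pos (mem_univ _)]
  ring

lemma sum_norm_fourierZ_sq_le {f : ZMod p → ℝ} (hf : ∀ x, |f x| ≤ 1) :
    ∑ r, ‖fourierZ f r‖ ^ 2 ≤ (p : ℝ) ^ 2 := by
  rw [sum_norm_fourierZ_sq, sq]
  gcongr
  calc ∑ x, f x ^ 2 ≤ ∑ _x : ZMod p, (1 : ℝ) :=
        sum_le_sum fun x _ => (sq_le_one_iff_abs_le_one _).2 (hf x)
    _ = p := by simp [ZMod.card]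

lemma norm_fourierZ_le {f : ZMod p → ℝ} (hf : ∀ x, |f x| ≤ 1) (r : ZMod p) :
    ‖fourierZ f r‖ ≤ p := by
  refine le_of_sq_le_sq ?_ (by positivity)
  exact (single_le_sum (f := fun r => ‖fourierZ f r‖ ^ 2) (fun _ _ => by positivity)
    (mem_univ r)).trans (sum_norm_fourierZ_sq_le hf)

lemma norm_one_sub_prod_le {ι : Type*} (s : Finset ι) {β : ι → ℂ} (hβ : ∀ i, ‖β i‖ ≤ 1) :
    ‖1 - ∏ i ∈ s, β i‖ ≤ ∑ i ∈ s, ‖1 - β i‖ := by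
  classical
  induction s using Finset.induction_on with
  | empty => simp
  | insert a s ha ih =>
    rw [prod_insert ha, sum_insert ha]
    have h : 1 - β a * ∏ i ∈ s, β i = (1 - β a) + β a * (1 - ∏ i ∈ s, β i) := by ring
    rw [h]
    refine (norm_add_le _ _).trans ?_
    rw [norm_mul]
    gcongr
    nlinarith [hβ a, norm_nonneg (1 - ∏ i ∈ s, β i)]

lemma prod_le_sum_sq {ι : Type*} {s u : Finset ι} (hsu : s ⊆ u) (hs : 2 ≤ #s) {a : ι → ℝ}
    (ha : ∀ i, 0 ≤ a i) (ha1 : ∀ i, a i ≤ 1) :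
    ∏ i ∈ s, a i ≤ ∑ i ∈ u, a i ^ 2 := by
  classical
  obtain ⟨j, hj, k, hk, hjk⟩ := one_lt_card.1 hs
  have hsub : {j, k} ⊆ s := by
    simp [insert_subset_iff, hj, hk]
  have h1 : ∏ i ∈ s, a i ≤ ∏ i ∈ {j, k}, a i := by
    rw [← prod_sdiff hsub]
    exact mul_le_of_le_one_left (prod_nonneg fun i _ => ha i)
      (prod_le_one (fun i _ => ha i) fun i _ => ha1 i)
  have h2 : ∑ i ∈ {j, k}, a i ^ 2 ≤ ∑ i ∈ u, a i ^ 2 :=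
    sum_le_sum_of_subset_of_nonneg (hsub.trans hsu) fun i _ _ => by positivity
  rw [prod_pair hjk] at h1
  rw [sum_pair hjk] at h2
  nlinarith [sq_nonneg (a j - a k), sq_nonneg (a j + a k)]

lemma abs_weightedCount_sub_le {t : ℕ} (ht : 3 ≤ t) {c : Fin t → ZMod p} (hc : ∀ i, c i ≠ 0)
    {f g : ZMod p → ℝ} (hf : ∀ x, |f x| ≤ 1) {β : ZMod p → ℂ} (hβ : ∀ r, ‖β r‖ ≤ 1)
    (hg : ∀ r, fourierZ g r = fourierZ f r * β r) {δ : ℝ} (hδ : 0 ≤ δ)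
    (hfβ : ∀ r, ‖fourierZ f r‖ * ‖1 - β r‖ ≤ δ * p) :
    |weightedCount c f - weightedCount c g| ≤ δ * t ^ 2 * p ^ (t - 1) := by
  have hp : (0 : ℝ) < p := by exact_mod_cast (Fact.out : p.Prime).pos
  set a : ZMod p → ℝ := fun r => ‖fourierZ f r‖ / p with ha
  have ha0 : ∀ r, 0 ≤ a r := fun r => by positivity
  have ha1 : ∀ r, a r ≤ 1 := fun r => (div_le_one hp).2 (norm_fourierZ_le hf r)
  have hF : ∀ r, ‖fourierZ f r‖ = p * a r := fun r => by rw [ha]; field_simp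
  have hasum : ∀ i, ∑ r, a (r * c i) ^ 2 ≤ 1 := by
    intro i
    have : ∑ r, a (r * c i) ^ 2 = ∑ r, a r ^ 2 :=
      Equiv.sum_comp (Equiv.mulRight₀ (c i) (hc i)) (fun r => a r ^ 2)
    rw [this]
    simp only [ha, div_pow]
    rw [← sum_div, div_le_one (by positivity)]
    exact sum_norm_fourierZ_sq_le hf
  have hterm : ∀ r, ‖∏ i, fourierZ f (r * c i) - ∏ i, fourierZ g (r * c i)‖ ≤
      t * (δ * p ^ t * ∑ i, a (r * c i) ^ 2) := by
    intro r
    simp only [hg, prod_mul_distrib]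
    have h1 : ∏ i, fourierZ f (r * c i) - (∏ i, fourierZ f (r * c i)) * ∏ i, β (r * c i) =
        (∏ i, fourierZ f (r * c i)) * (1 - ∏ i, β (r * c i)) := by ring
    rw [h1, norm_mul, norm_prod]
    refine (mul_le_mul_of_nonneg_left (norm_one_sub_prod_le univ fun i => hβ (r * c i))
      (prod_nonneg fun i _ => norm_nonneg _)).trans ?_
    rw [mul_sum]
    have h2 : ∀ i : Fin t, (∏ j, ‖fourierZ f (r * c j)‖) * ‖1 - β (r * c i)‖ ≤
        δ * p ^ t * ∑ i, a (r * c i) ^ 2 := by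
      intro i
      have hcard : #(univ.erase i) = t - 1 := by simp
      have h3 : ∏ j ∈ univ.erase i, a (r * c j) ≤ ∑ j, a (r * c j) ^ 2 :=
        prod_le_sum_sq (subset_univ _) (by rw [hcard]; lia) (fun j => ha0 _) fun j => ha1 _
      rw [← mul_prod_erase univ _ (mem_univ i)]
      have h4 : ∏ j ∈ univ.erase i, ‖fourierZ f (r * c j)‖ =
          p ^ (t - 1) * ∏ j ∈ univ.erase i, a (r * c j) := by
        simp only [hF, prod_mul_distrib, prod_const, hcard]
      rw [h4]
      have h5 : (p : ℝ) ^ t = p * p ^ (t - 1) := by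
        rw [← pow_succ']
        congr 1
        lia
      rw [h5]
      calc _ = (‖fourierZ f (r * c i)‖ * ‖1 - β (r * c i)‖) * p ^ (t - 1) *
            ∏ j ∈ univ.erase i, a (r * c j) := by ring
        _ ≤ (δ * p) * p ^ (t - 1) * ∑ j, a (r * c j) ^ 2 := by
            have := hfβ (r * c i)
            have h6 : 0 ≤ ∏ j ∈ univ.erase i, a (r * c j) := prod_nonneg fun j _ => ha0 _
            gcongr ?_ * _ * ?_
        _ = _ := by ring
    refine (sum_le_sum fun i _ => h2 i).trans (le_of_eq ?_)
    simp
  have hmain : p * |weightedCount c f - weightedCount c g| ≤ t * (δ * p ^ t * t) := by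
    have h1 : p * |weightedCount c f - weightedCount c g| =
        ‖∑ r, (∏ i, fourierZ f (r * c i) - ∏ i, fourierZ g (r * c i))‖ := by
      rw [sum_sub_distrib, sum_prod_fourierZ, sum_prod_fourierZ, ← mul_sub, norm_mul,
        ← Complex.ofReal_sub, Complex.norm_real, Real.norm_eq_abs, Complex.norm_natCast]
    rw [h1]
    refine (norm_sum_le_of_le _ fun r _ => hterm r).trans ?_
    rw [← mul_sum, ← mul_sum, sum_comm]
    gcongr
    exact (sum_le_sum fun i _ => hasum i).trans (by simp)
  have h5 : (p : ℝ) ^ t = p * p ^ (t - 1) := by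
    rw [← pow_succ']
    congr 1
    lia
  rw [h5] at hmain
  refine le_of_mul_le_mul_left (hmain.trans (le_of_eq ?_)) hp
  ring

/-- The average of `f` along the progression of length `l` and difference `q`. -/
def progAverage (l : ℕ) (q : ZMod p) (f : ZMod p → ℝ) (x : ZMod p) : ℝ :=
  (∑ y ∈ range l, f (x + q * (y : ZMod p))) / l

lemma fourierZ_progAverage (l : ℕ) (q : ZMod p) (f : ZMod p → ℝ) (r : ZMod p) :
    fourierZ (progAverage l q f) r =
      fourierZ f r * ((∑ y ∈ range l, ZMod.stdAddChar (-(r * q * (y : ZMod p)))) / l) := by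
  have h : ∀ y : ℕ, ∑ x, (f (x + q * (y : ZMod p)) : ℂ) * ZMod.stdAddChar (r * x) =
      fourierZ f r * ZMod.stdAddChar (-(r * q * (y : ZMod p))) := by
    intro y
    rw [fourierZ, sum_mul, ← Equiv.sum_comp (Equiv.addRight (q * (y : ZMod p)))
      (fun x => (f x : ℂ) * ZMod.stdAddChar (r * x) * ZMod.stdAddChar (-(r * q * (y : ZMod p))))]
    refine sum_congr rfl fun x _ => ?_
    simp only [Equiv.coe_addRight]
    rw [mul_assoc, ← AddChar.map_add_eq_mul]
    congr 2
    ring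
  rw [mul_div_assoc', mul_sum, ← sum_congr rfl fun y _ => h y, sum_comm, fourierZ, sum_div]
  refine sum_congr rfl fun x _ => ?_
  simp only [progAverage]
  push_cast
  rw [← sum_mul]
  ring

lemma exists_dilate_small (R : Finset (ZMod p)) {Q : ℕ} (hQ : 0 < Q) (h : Q ^ #R < p) :
    ∃ q : ZMod p, q ≠ 0 ∧ ∀ r ∈ R, ∃ a : ℤ, (a : ZMod p) = r * q ∧ |a| * Q ≤ p := by
  have hp : 0 < p := (Fact.out : p.Prime).pos
  set φ : ZMod p → R → Fin Q := fun x r => ⟨(r.1 * x).val * Q / p, by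
    rw [Nat.div_lt_iff_lt_mul hp, mul_comm Q]
    exact Nat.mul_lt_mul_of_pos_right (ZMod.val_lt _) hQ⟩ with hφ
  obtain ⟨x, y, hxy, heq⟩ := Fintype.exists_ne_map_eq_of_card_lt φ (by simpa [ZMod.card] using h)
  refine ⟨x - y, sub_ne_zero.2 hxy, fun r hr => ⟨(r * x).val - (r * y).val, ?_, ?_⟩⟩
  · push_cast
    simp [mul_sub]
  · have h1 : (r * x).val * Q / p = (r * y).val * Q / p :=
      congrArg Fin.val (congrFun heq ⟨r, hr⟩)
    set u := (r * x).val
    set v := (r * y).val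
    have h2 := Nat.div_add_mod (u * Q) p
    have h3 := Nat.div_add_mod (v * Q) p
    rw [h1] at h2
    have h4 := Nat.mod_lt (u * Q) hp
    have h5 := Nat.mod_lt (v * Q) hp
    have h6 : |((u : ℤ) - v)| * Q = |(u * Q : ℤ) - v * Q| := by
      rw [← sub_mul, abs_mul, Nat.abs_cast]
    rw [h6, abs_le]
    set w := p * (v * Q / p)
    zify at h2 h3 h4 h5
    have h7 : (0 : ℤ) ≤ (u * Q : ℤ) % p := Int.emod_nonneg _ (by positivity)
    have h8 : (0 : ℤ) ≤ (v * Q : ℤ) % p := Int.emod_nonneg _ (by positivity)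
    constructor <;> linarith

lemma norm_one_sub_stdAddChar_le {a : ℤ} {Q l y : ℕ} (hQ : 0 < Q) (ha : |a| * Q ≤ p)
    (hy : y ≤ l) {x : ZMod p} (hx : (a : ZMod p) = x) :
    ‖1 - ZMod.stdAddChar (-(x * (y : ZMod p)))‖ ≤ 2 * Real.pi * l / Q := by
  have hp : (0 : ℝ) < p := by exact_mod_cast (Fact.out : p.Prime).pos
  have h1 : -(x * (y : ZMod p)) = ((-(a * y) : ℤ) : ZMod p) := by
    push_cast
    rw [hx]
  have ha' : |(a : ℝ)| * Q ≤ p := by exact_mod_cast ha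
  have h2 : (2 * Real.pi * Complex.I * ((-(a * y) : ℤ) : ℂ) / p : ℂ) =
      Complex.I * ((2 * Real.pi * (-(a * y)) / p : ℝ) : ℂ) := by
    push_cast
    ring
  rw [norm_sub_rev, h1, ZMod.stdAddChar_coe, h2]
  refine (Real.norm_exp_I_mul_ofReal_sub_one_le).trans ?_
  rw [Real.norm_eq_abs, abs_div, abs_mul (2 * Real.pi), abs_neg, abs_mul (a : ℝ),
    Nat.abs_cast, Nat.abs_cast, abs_of_pos Real.two_pi_pos, div_le_div_iff₀ hp (by positivity)]
  have hy' : (y : ℝ) ≤ l := by exact_mod_cast hy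
  calc 2 * Real.pi * (|(a : ℝ)| * y) * Q = 2 * Real.pi * y * (|(a : ℝ)| * Q) := by ring
    _ ≤ 2 * Real.pi * l * p := by gcongr

/-- Averaging along a suitable progression hardly changes the weighted number of solutions of
linear equations in at least three variables. -/
theorem exists_progAverage {l : ℕ} (hl : 0 < l) {δ : ℝ} (hδ : 0 < δ) :
    ∃ N : ℕ, ∀ (p : ℕ) [Fact p.Prime], N ≤ p → ∀ f : ZMod p → ℝ, (∀ x, |f x| ≤ 1) →
      ∃ q : ZMod p, q ≠ 0 ∧ ∀ {t : ℕ} (c : Fin t → ZMod p), 3 ≤ t → (∀ i, c i ≠ 0) →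
        |weightedCount c f - weightedCount c (progAverage l q f)| ≤ δ * t ^ 2 * p ^ (t - 1) := by
  have hlR : (0 : ℝ) < l := by exact_mod_cast hl
  set K := ⌊4 / δ ^ 2⌋₊ with hK
  set Q := ⌈2 * Real.pi * l / δ⌉₊ with hQ
  have hQ0 : 0 < Q := Nat.ceil_pos.2 (by positivity)
  refine ⟨Q ^ K + 1, fun p _ hp f hf => ?_⟩
  have hp0 : (0 : ℝ) < p := by exact_mod_cast (Fact.out : p.Prime).pos
  set R : Finset (ZMod p) := {r | δ * p / 2 ≤ ‖fourierZ f r‖} with hR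
  have hRK : #R ≤ K := by
    refine Nat.le_floor ?_
    rw [le_div_iff₀ (by positivity)]
    have h1 : #R * (δ * p / 2) ^ 2 ≤ (p : ℝ) ^ 2 := by
      calc #R * (δ * p / 2) ^ 2 = ∑ r ∈ R, (δ * p / 2) ^ 2 := by simp
        _ ≤ ∑ r ∈ R, ‖fourierZ f r‖ ^ 2 := by
          refine sum_le_sum fun r hr => ?_
          have := (mem_filter.1 hr).2
          gcongr
        _ ≤ ∑ r, ‖fourierZ f r‖ ^ 2 :=
          sum_le_sum_of_subset_of_nonneg (subset_univ _) fun _ _ _ => by positivity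
        _ ≤ _ := sum_norm_fourierZ_sq_le hf
    have hp2 : (0 : ℝ) < p ^ 2 := by positivity
    refine le_of_mul_le_mul_right ?_ hp2
    nlinarith
  obtain ⟨q, hq, hqR⟩ := exists_dilate_small R hQ0
    ((Nat.pow_le_pow_right hQ0 hRK).trans_lt (by lia))
  refine ⟨q, hq, fun {t} c ht hc => abs_weightedCount_sub_le ht hc hf
    (β := fun r => (∑ y ∈ range l, ZMod.stdAddChar (-(r * q * (y : ZMod p)))) / l) ?_
    (fourierZ_progAverage l q f) hδ.le ?_⟩
  · intro r
    rw [norm_div, Complex.norm_natCast, div_le_one hlR]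
    refine (norm_sum_le _ _).trans (le_of_eq ?_)
    simp
  · intro r
    have hβ : ∀ s : ℝ, (∀ y ∈ range l, ‖1 - ZMod.stdAddChar (-(r * q * (y : ZMod p)))‖ ≤ s) →
        ‖1 - (∑ y ∈ range l, ZMod.stdAddChar (-(r * q * (y : ZMod p)))) / (l : ℂ)‖ ≤ s := by
      intro s hs
      have h1 : 1 - (∑ y ∈ range l, ZMod.stdAddChar (-(r * q * (y : ZMod p)))) / (l : ℂ) =
          (∑ y ∈ range l, (1 - ZMod.stdAddChar (-(r * q * (y : ZMod p))))) / l := by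
        have : (l : ℂ) ≠ 0 := by exact_mod_cast hl.ne'
        simp [sum_sub_distrib]
        field_simp
      rw [h1, norm_div, Complex.norm_natCast, div_le_iff₀ hlR]
      refine (norm_sum_le_of_le _ hs).trans (le_of_eq ?_)
      simp [mul_comm]
    by_cases hr : r ∈ R
    · obtain ⟨a, ha, haQ⟩ := hqR r hr
      have h1 := hβ δ fun y hy => by
        refine (norm_one_sub_stdAddChar_le hQ0 haQ (mem_range.1 hy).le ha).trans ?_
        rw [div_le_iff₀ (by exact_mod_cast hQ0), ← div_le_iff₀' hδ]
        exact Nat.le_ceil _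
      calc _ ≤ p * δ := by
            gcongr
            exact norm_fourierZ_le hf r
        _ = _ := mul_comm _ _
    · have h1 := hβ 2 fun y _ => by
        refine (norm_sub_le _ _).trans (le_of_eq ?_)
        rw [norm_stdAddChar, norm_one]
        norm_num
      have h2 : ‖fourierZ f r‖ < δ * p / 2 := by
        by_contra! h
        exact hr (mem_filter.2 ⟨mem_univ _, h⟩)
      calc _ ≤ (δ * p / 2) * 2 := by gcongr
        _ = _ := by ring

end Fourier

section Structure

open Finset

lemma exists_removal_zmod (m : ℕ) {ε : ℝ} (hε : 0 < ε) :
    ∃ δ > 0, ∃ N : ℕ, ∀ (p : ℕ) [Fact p.Prime], N ≤ p → ∀ c : Fin (m + 3) → ZMod p,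
      (∀ i, c i ≠ 0) → ∀ A : Finset (ZMod p),
      (#{x : Fin (m + 3) → ZMod p | (∀ i, x i ∈ A) ∧ ∑ i, c i * x i = 0} : ℝ) <
        δ * (p : ℝ) ^ (m + 2) →
      ∃ R : Finset (ZMod p), (#R : ℝ) ≤ ε * p ∧
        ∀ x : Fin (m + 3) → ZMod p, (∀ i, x i ∈ A \ R) → ∑ i, c i * x i ≠ 0 := by
  obtain ⟨δ, hδ, N, h⟩ := exists_removal m (ε := ε / (m + 3)) (by positivity)
  refine ⟨δ, hδ, N, fun p _ hp c hc A hA => ?_⟩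
  have hcount : solCount (fun i => A.image (c i * ·)) 0 ≤
      #{x : Fin (m + 3) → ZMod p | (∀ i, x i ∈ A) ∧ ∑ i, c i * x i = 0} := by
    refine card_le_card_of_injOn (fun b i => (c i)⁻¹ * b i) ?_ ?_
    · intro b hb
      simp only [coe_filter, Fintype.mem_piFinset, mem_image, Set.mem_ofPred_eq] at hb
      simp only [coe_filter, mem_univ, true_and, Set.mem_ofPred_eq]
      refine ⟨fun i => ?_, ?_⟩
      · obtain ⟨y, hy, hyb⟩ := hb.1 i
        rwa [← hyb, inv_mul_cancel_left₀ (hc i)]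
      · simpa [mul_inv_cancel_left₀ (hc _)] using hb.2
    · intro b _ b' _ hbb
      funext i
      exact mul_left_cancel₀ (inv_ne_zero (hc i)) (congrFun hbb i)
  obtain ⟨R, hR, hR'⟩ := h (ZMod p) (by rwa [ZMod.card]) (fun i => A.image (c i * ·)) (by
    rw [ZMod.card]
    exact lt_of_le_of_lt (by exact_mod_cast hcount) hA)
  refine ⟨univ.biUnion fun i => (R i).image ((c i)⁻¹ * ·), ?_, fun x hx => ?_⟩
  · have h1 := (card_biUnion_le (s := univ) (t := fun i => (R i).image ((c i)⁻¹ * ·))).trans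
      (sum_le_sum fun i _ => card_image_le)
    refine (Nat.cast_le.2 h1).trans ?_
    push_cast
    refine (sum_le_sum fun i _ => hR i).trans (le_of_eq ?_)
    rw [ZMod.card]
    simp
    field_simp
  · refine hR' (fun i => c i * x i) fun i => ⟨mem_image_of_mem _ (mem_sdiff.1 (hx i)).1, ?_⟩
    intro hi
    refine (mem_sdiff.1 (hx i)).2 (mem_biUnion.2 ⟨i, mem_univ _, mem_image.2 ⟨_, hi, ?_⟩⟩)
    exact inv_mul_cancel_left₀ (hc i) _

variable {p : ℕ} [Fact p.Prime]

lemma abs_progAverage_add_sub_le {l : ℕ} (hl : 0 < l) (q : ZMod p) {f : ZMod p → ℝ}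
    (hf0 : ∀ x, 0 ≤ f x) (hf1 : ∀ x, f x ≤ 1) (j : ℤ) (x : ZMod p) :
    |progAverage l q f (x + q * j) - progAverage l q f x| ≤ |(j : ℝ)| / l := by
  have hlR : (0 : ℝ) < l := by exact_mod_cast hl
  have hstep : ∀ x, |progAverage l q f (x + q) - progAverage l q f x| ≤ 1 / l := by
    intro x
    have h1 : ∑ y ∈ range l, f (x + q + q * (y : ZMod p)) -
        ∑ y ∈ range l, f (x + q * (y : ZMod p)) = f (x + q * (l : ZMod p)) - f x := by
      rw [← sum_sub_distrib]
      have := sum_range_sub (fun y : ℕ => f (x + q * (y : ZMod p))) l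
      simp only [Nat.cast_zero, mul_zero, add_zero] at this
      rw [← this]
      refine sum_congr rfl fun y _ => ?_
      push_cast
      congr 2
      ring
    rw [progAverage, progAverage, ← sub_div, h1, abs_div, abs_of_pos hlR]
    gcongr
    rw [abs_le]
    constructor <;> linarith [hf0 x, hf1 x, hf0 (x + q * (l : ZMod p)), hf1 (x + q * (l : ZMod p))]
  have hnat : ∀ (j : ℕ) (x : ZMod p),
      |progAverage l q f (x + q * j) - progAverage l q f x| ≤ j / l := by
    intro j x
    induction j with
    | zero => simp
    | succ j ih =>
      have h1 : x + q * ((j + 1 : ℕ) : ZMod p) = x + q * j + q := by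
        push_cast
        ring
      rw [h1]
      refine (abs_sub_le _ (progAverage l q f (x + q * j)) _).trans ?_
      push_cast
      rw [add_div]
      linarith [hstep (x + q * j)]
  obtain ⟨k, rfl | rfl⟩ := j.eq_nat_or_neg
  · simpa using hnat k x
  · have := hnat k (x + q * ((-k : ℤ) : ZMod p))
    rw [abs_sub_comm]
    simpa using this

lemma weightedCount_indicator_eq_zero {t : ℕ} (c : Fin t → ℤ) {A : Finset (ZMod p)}
    (hA : IsLFree c (A : Set (ZMod p))) :
    weightedCount (fun i => (c i : ZMod p)) (fun x => if x ∈ A then 1 else 0) = 0 := by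
  refine sum_eq_zero fun x hx => ?_
  have h1 : ∃ i, x i ∉ A := by
    by_contra! h
    exact hA ⟨x, fun i => h i, by simpa [zsmul_eq_mul] using hx⟩
  obtain ⟨i, hi⟩ := h1
  exact prod_eq_zero (mem_univ i) (by simp [hi])

lemma card_mul_pow_le_weightedCount {t : ℕ} (c : Fin t → ZMod p) {g : ZMod p → ℝ}
    (hg : ∀ x, 0 ≤ g x) {τ : ℝ} (hτ : 0 ≤ τ) {A : Finset (ZMod p)} (hA : ∀ x ∈ A, τ ≤ g x) :
    (#{x : Fin t → ZMod p | (∀ i, x i ∈ A) ∧ ∑ i, c i * x i = 0} : ℝ) * τ ^ t ≤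
      weightedCount c g := by
  rw [weightedCount, ← nsmul_eq_mul, ← sum_const]
  refine (sum_le_sum (g := fun x => ∏ i, g (x i)) fun x hx => ?_).trans
    (sum_le_sum_of_subset_of_nonneg ?_ fun x _ _ => prod_nonneg fun i _ => hg _)
  · have h1 : τ ^ t = ∏ _i : Fin t, τ := by simp
    rw [h1]
    exact prod_le_prod (fun _ _ => hτ) fun i _ => hA _ ((mem_filter.1 hx).2.1 i)
  · intro x hx
    simp only [mem_filter, mem_univ, true_and] at hx ⊢
    exact hx.2

lemma sum_progAverage {l : ℕ} (hl : 0 < l) (q : ZMod p) (f : ZMod p → ℝ) :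
    ∑ x, progAverage l q f x = ∑ x, f x := by
  have hlR : (l : ℝ) ≠ 0 := by exact_mod_cast hl.ne'
  simp only [progAverage]
  rw [← sum_div, sum_comm, div_eq_iff hlR]
  have : ∀ y : ℕ, ∑ x, f (x + q * (y : ZMod p)) = ∑ x, f x := fun y =>
    Equiv.sum_comp (Equiv.addRight (q * (y : ZMod p))) f
  simp [this, mul_comm]

/-- An `𝓕`-free subset of `ZMod p` is, up to few elements, contained in the set of points around
which a progression lies in a possibly different `𝓕`-free set. -/
theorem exists_structured {n : ℕ} {t : Fin n → ℕ} (c : ∀ i, Fin (t i) → ℤ)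
    (ht : ∀ i, 3 ≤ t i) (C : ℕ) {ε : ℝ} (hε : 0 < ε) :
    ∃ N : ℕ, ∀ (p : ℕ) [Fact p.Prime], N ≤ p → (∀ i j, (c i j : ZMod p) ≠ 0) →
      ∀ A : Finset (ZMod p),
      (∀ i, IsLFree (c i) (A : Set (ZMod p))) → ∃ q : ZMod p, q ≠ 0 ∧ ∃ A₃ A₄ : Finset (ZMod p),
        (#A : ℝ) ≤ #A₄ + ε * p ∧ (∀ i, IsLFree (c i) (A₃ : Set (ZMod p))) ∧
        ∀ x ∈ A₄, ∀ j : ℤ, |j| ≤ C → x + q * j ∈ A₃ := by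
  set τ := ε / 2 with hτ
  have hτ0 : 0 < τ := by positivity
  obtain ⟨l, hl⟩ := exists_nat_gt (2 * C / τ)
  have hl0 : 0 < l := by
    have : (0 : ℝ) < l := lt_of_le_of_lt (by positivity) hl
    exact_mod_cast this
  have hlR : (0 : ℝ) < l := by exact_mod_cast hl0
  set ε₁ := ε / (2 * (2 * C + 1) * (n + 1)) with hε₁
  have hrem : ∀ i, ∃ δ > 0, ∃ N : ℕ, ∀ (p : ℕ) [Fact p.Prime], N ≤ p →
      (∀ j, (c i j : ZMod p) ≠ 0) → ∀ A : Finset (ZMod p),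
      (#{x : Fin (t i) → ZMod p | (∀ j, x j ∈ A) ∧ ∑ j, (c i j : ZMod p) * x j = 0} : ℝ) <
        δ * (p : ℝ) ^ (t i - 1) →
      ∃ R : Finset (ZMod p), (#R : ℝ) ≤ ε₁ * p ∧
        ∀ x : Fin (t i) → ZMod p, (∀ j, x j ∈ A \ R) → ∑ j, (c i j : ZMod p) * x j ≠ 0 := by
    intro i
    obtain ⟨m, hm⟩ := Nat.exists_eq_add_of_le' (ht i)
    generalize c i = c' at *
    generalize t i = t' at *
    subst hm
    obtain ⟨δ, hδ, N, h⟩ := exists_removal_zmod m (ε := ε₁) (by positivity)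
    exact ⟨δ, hδ, N, fun p _ hp hcp A hA => h p hp (fun j => c' j) hcp A hA⟩
  choose δ hδ N hN using hrem
  obtain ⟨δ₀, hδ₀, hδ₀'⟩ : ∃ δ₀ > 0, ∀ i, δ₀ * (t i : ℝ) ^ 2 < δ i * (τ / 2) ^ t i := by
    have h1 : ∀ᶠ s : ℝ in nhdsWithin 0 (Set.Ioi 0),
        ∀ i, s * (t i : ℝ) ^ 2 < δ i * (τ / 2) ^ t i := by
      refine Filter.eventually_all.2 fun i => ?_
      have h2 : Filter.Tendsto (fun s : ℝ => s * (t i : ℝ) ^ 2) (nhdsWithin 0 (Set.Ioi 0))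
          (nhds (0 * (t i : ℝ) ^ 2)) :=
        ((continuous_id.mul continuous_const).tendsto 0).mono_left nhdsWithin_le_nhds
      rw [zero_mul] at h2
      exact h2.eventually_lt_const (mul_pos (hδ i) (by positivity))
    obtain ⟨s, hs, hs0⟩ := (h1.and self_mem_nhdsWithin).exists
    exact ⟨s, hs0, hs⟩
  obtain ⟨N₀, hN₀⟩ := exists_progAverage hl0 hδ₀
  refine ⟨N₀ + ∑ i, N i, fun p _ hp hcp A hA => ?_⟩
  have hp0 : (0 : ℝ) < p := by exact_mod_cast (Fact.out : p.Prime).pos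
  have hNp : ∀ i, N i ≤ p := fun i =>
    (single_le_sum (f := N) (fun _ _ => Nat.zero_le _) (mem_univ i)).trans (by lia)
  set f : ZMod p → ℝ := fun x => if x ∈ A then 1 else 0 with hf
  have hf0 : ∀ x, 0 ≤ f x := fun x => by
    simp only [hf]
    split_ifs <;> norm_num
  have hf1 : ∀ x, f x ≤ 1 := fun x => by
    simp only [hf]
    split_ifs <;> norm_num
  obtain ⟨q, hq, hcount⟩ := hN₀ p (by lia) f fun x => by
    rw [abs_of_nonneg (hf0 x)]
    exact hf1 x
  set g := progAverage l q f with hg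
  have hg0 : ∀ x, 0 ≤ g x := fun x => by
    have : 0 ≤ ∑ y ∈ range l, f (x + q * (y : ZMod p)) := sum_nonneg fun _ _ => hf0 _
    rw [hg, progAverage]
    positivity
  have hg1 : ∀ x, g x ≤ 1 := fun x => by
    rw [hg, progAverage, div_le_one hlR]
    exact (sum_le_sum fun _ _ => hf1 _).trans (by simp)
  set A₂ : Finset (ZMod p) := {x | τ / 2 ≤ g x} with hA₂
  have hR : ∀ i, ∃ R : Finset (ZMod p), (#R : ℝ) ≤ ε₁ * p ∧
      ∀ x : Fin (t i) → ZMod p, (∀ j, x j ∈ A₂ \ R) → ∑ j, (c i j : ZMod p) * x j ≠ 0 := by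
    intro i
    refine hN i p (hNp i) (hcp i) A₂ ?_
    have h1 := hcount (fun j => (c i j : ZMod p)) (ht i) (hcp i)
    rw [weightedCount_indicator_eq_zero (c i) (hA i), zero_sub, abs_neg] at h1
    have h2 := card_mul_pow_le_weightedCount (fun j => (c i j : ZMod p)) hg0 (τ := τ / 2)
      (by positivity) (A := A₂) fun x hx => (mem_filter.1 hx).2
    have h3 : (0 : ℝ) < p ^ (t i - 1) := by positivity
    have h4 : (0 : ℝ) < (τ / 2) ^ t i := by positivity
    refine lt_of_mul_lt_mul_right ?_ h4.le
    calc _ ≤ δ₀ * (t i : ℝ) ^ 2 * p ^ (t i - 1) := h2.trans ((le_abs_self _).trans h1)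
      _ < δ i * (τ / 2) ^ t i * p ^ (t i - 1) := mul_lt_mul_of_pos_right (hδ₀' i) h3
      _ = _ := by ring
  choose R hRcard hRfree using hR
  set R' := univ.biUnion R with hR'
  have hR'card : (#R' : ℝ) ≤ n * (ε₁ * p) := by
    refine (Nat.cast_le.2 card_biUnion_le).trans ?_
    push_cast
    exact (sum_le_sum fun i _ => hRcard i).trans (by simp)
  set A₁ : Finset (ZMod p) := {x | τ ≤ g x} with hA₁
  set bad := (Finset.Icc (-C : ℤ) C).biUnion fun j => R'.image fun x => x - q * (j : ZMod p)
    with hbad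
  have hbadcard : (#bad : ℝ) ≤ ε / 2 * p := by
    have h1 : #bad ≤ (2 * C + 1) * #R' := by
      refine card_biUnion_le.trans ((sum_le_sum fun j _ => card_image_le).trans (le_of_eq ?_))
      simp
      left
      lia
    have h2 : (#bad : ℝ) ≤ (2 * C + 1) * #R' := by exact_mod_cast h1
    refine h2.trans ((mul_le_mul_of_nonneg_left hR'card (by positivity)).trans ?_)
    have h3 : (2 * C + 1 : ℝ) * (n * (ε₁ * p)) = ε / 2 * p * (n / (n + 1)) := by
      rw [hε₁]
      field_simp
    rw [h3]
    refine mul_le_of_le_one_right (by positivity) ?_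
    rw [div_le_one (by positivity)]
    linarith
  refine ⟨q, hq, A₂ \ R', A₁ \ bad, ?_, fun i => ?_, fun x hx j hj => ?_⟩
  · have h1 : (#A : ℝ) ≤ #A₁ + τ * p := by
      calc (#A : ℝ) = ∑ x, f x := by simp [hf]
        _ = ∑ x, g x := (sum_progAverage hl0 q f).symm
        _ ≤ ∑ x, ((if x ∈ A₁ then 1 else 0) + τ) := by
          refine sum_le_sum fun x _ => ?_
          split_ifs with h
          · linarith [hg1 x]
          · rw [hA₁, mem_filter, not_and, not_le] at h
            linarith [h (mem_univ x)]
        _ = #A₁ + τ * p := by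
          rw [sum_add_distrib]
          simp [ZMod.card, mul_comm]
    have h2 : (#A₁ : ℝ) ≤ #(A₁ \ bad) + #bad := by
      have := card_le_card_sdiff_add_card (s := A₁) (t := bad)
      exact_mod_cast this
    rw [hτ] at h1
    linarith
  · rintro ⟨x, hx, hsum⟩
    refine hRfree i x (fun j => ?_) (by simpa [zsmul_eq_mul] using hsum)
    have := mem_sdiff.1 (mem_coe.1 (hx j))
    exact mem_sdiff.2 ⟨this.1, fun h => this.2 (mem_biUnion.2 ⟨i, mem_univ _, h⟩)⟩
  · obtain ⟨hx1, hx2⟩ := mem_sdiff.1 hx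
    refine mem_sdiff.2 ⟨mem_filter.2 ⟨mem_univ _, ?_⟩, fun h => hx2 ?_⟩
    · have h1 := abs_progAverage_add_sub_le hl0 q hf0 hf1 j x
      have h2 : |(j : ℝ)| / l ≤ τ / 2 := by
        have h3 : |(j : ℝ)| ≤ C := by exact_mod_cast hj
        rw [div_lt_iff₀ hτ0] at hl
        rw [div_le_iff₀ hlR]
        linarith
      have h3 := (mem_filter.1 hx1).2
      have h4 := (abs_le.1 h1).1
      linarith
    · rw [abs_le] at hj
      exact mem_biUnion.2 ⟨j, Finset.mem_Icc.2 hj, mem_image.2 ⟨_, h, by ring⟩⟩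

end Structure

section Circle

open Finset

variable {p : ℕ} [NeZero p]

/-- The class modulo `p` of the index `j` of the interval `[j / p, (j + 1) / p)` containing `x`. -/
def cellIndex (p : ℕ) (x : UnitAddCircle) : ZMod p :=
  (⌊(p : ℝ) * AddCircle.measurableEquivIco 1 0 x⌋ : ℤ)

omit [NeZero p] in
lemma cellIndex_coe (y : ℝ) : cellIndex p (y : UnitAddCircle) = (⌊(p : ℝ) * y⌋ : ℤ) := by
  have h1 : ((AddCircle.measurableEquivIco 1 0 (y : UnitAddCircle) : Set.Ico (0 : ℝ) (0 + 1)) : ℝ) =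
      Int.fract y := by
    have := AddCircle.coe_equivIco_mk_apply (p := (1 : ℝ)) y
    rw [div_one, mul_one] at this
    exact this
  have h2 : (p : ℝ) * Int.fract y = p * y - ((p * ⌊y⌋ : ℤ) : ℝ) := by
    rw [Int.fract]
    push_cast
    ring
  rw [cellIndex, h1, h2, Int.floor_sub_intCast]
  push_cast
  simp

omit [NeZero p] in
lemma measurableSet_preimage_cellIndex (S : Set (ZMod p)) :
    MeasurableSet (cellIndex p ⁻¹' S) := by
  have h1 : Measurable fun x : UnitAddCircle =>
      ⌊(p : ℝ) * (AddCircle.measurableEquivIco 1 0 x : Set.Ico (0 : ℝ) (0 + 1))⌋ :=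
    Int.measurable_floor.comp (measurable_const.mul
      (measurable_subtype_coe.comp (AddCircle.measurableEquivIco 1 0).measurable))
  exact h1 (MeasurableSet.of_discrete (s := {m : ℤ | (m : ZMod p) ∈ S}))

lemma cellIndex_add_toAddCircle (x : UnitAddCircle) (j : ZMod p) :
    cellIndex p (x + ZMod.toAddCircle j) = cellIndex p x + j := by
  obtain ⟨y, rfl⟩ := QuotientAddGroup.mk_surjective x
  obtain ⟨k, rfl⟩ := ZMod.intCast_surjective j
  have hp : (p : ℝ) ≠ 0 := by exact_mod_cast NeZero.ne p
  change cellIndex p ((y : UnitAddCircle) + _) = cellIndex p (y : UnitAddCircle) + _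
  rw [ZMod.toAddCircle_intCast, ← AddCircle.coe_add, cellIndex_coe, cellIndex_coe, mul_add,
    mul_div_cancel₀ _ hp, Int.floor_add_intCast]
  push_cast
  rfl

lemma norm_sub_toAddCircle_cellIndex_le (x : UnitAddCircle) :
    ‖x - ZMod.toAddCircle (cellIndex p x)‖ ≤ 1 / p := by
  obtain ⟨y, rfl⟩ := QuotientAddGroup.mk_surjective x
  have hp : (0 : ℝ) < p := by exact_mod_cast Nat.pos_of_ne_zero (NeZero.ne p)
  change ‖(y : UnitAddCircle) - ZMod.toAddCircle (cellIndex p (y : UnitAddCircle))‖ ≤ _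
  rw [cellIndex_coe, ZMod.toAddCircle_intCast, ← AddCircle.coe_sub]
  refine QuotientAddGroup.norm_mk_le_norm.trans ?_
  have h1 : y - ⌊(p : ℝ) * y⌋ / p = Int.fract ((p : ℝ) * y) / p := by
    rw [Int.fract]
    field_simp
  rw [h1, Real.norm_eq_abs, abs_div, abs_of_pos hp, abs_of_nonneg (Int.fract_nonneg _)]
  gcongr
  exact (Int.fract_lt_one _).le

lemma volume_real_preimage_cellIndex (S : Finset (ZMod p)) :
    (volume (cellIndex p ⁻¹' (S : Set (ZMod p)))).toReal = #S / p := by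
  have hp : (p : ℝ) ≠ 0 := by exact_mod_cast NeZero.ne p
  have hfib : ∀ j : ZMod p, volume (cellIndex p ⁻¹' {j}) = volume (cellIndex p ⁻¹' {0}) := by
    intro j
    rw [← measure_preimage_add_right volume (ZMod.toAddCircle j) (cellIndex p ⁻¹' {j})]
    congr 1
    ext x
    simp [cellIndex_add_toAddCircle]
  have hsum : ∀ S : Finset (ZMod p), volume (cellIndex p ⁻¹' (S : Set (ZMod p))) =
      #S * volume (cellIndex p ⁻¹' {0}) := by
    intro S
    rw [← sum_measure_preimage_singleton S fun j _ => measurableSet_preimage_cellIndex _]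
    simp [hfib]
  have huniv := hsum univ
  rw [coe_univ, Set.preimage_univ, UnitAddCircle.measure_univ, card_univ, ZMod.card] at huniv
  have h1 : (1 : ℝ) = p * (volume (cellIndex p ⁻¹' {0})).toReal := by
    have := congrArg ENNReal.toReal huniv
    simpa using this
  rw [hsum, ENNReal.toReal_mul, ENNReal.toReal_natCast, eq_div_iff hp]
  linear_combination (-(#S : ℝ)) * h1

omit [NeZero p] in
lemma exists_sum_cellIndex_eq {t : ℕ} (c : Fin t → ℤ) {x : Fin t → UnitAddCircle}
    (hx : ∑ i, c i • x i = 0) :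
    ∃ e : ℤ, |e| ≤ ∑ i, |c i| ∧ ∑ i, (c i : ZMod p) * cellIndex p (x i) = e := by
  choose y hy using fun i => QuotientAddGroup.mk_surjective (x i)
  have hy' : ∀ i, x i = (y i : UnitAddCircle) := fun i => (hy i).symm
  obtain ⟨k, hk⟩ : ∃ k : ℤ, (k : ℝ) = ∑ i, c i * y i := by
    have h1 : ((∑ i, c i * y i : ℝ) : UnitAddCircle) = 0 := by
      rw [← hx]
      simp only [hy', ← AddCircle.coe_zsmul, zsmul_eq_mul]
      exact map_sum (QuotientAddGroup.mk' _) _ _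
    obtain ⟨k, hk⟩ := (AddCircle.coe_eq_zero_iff 1).1 h1
    exact ⟨k, by simpa using hk⟩
  refine ⟨∑ i, c i * ⌊(p : ℝ) * y i⌋ - p * k, ?_, ?_⟩
  · have h1 : ((∑ i, c i * ⌊(p : ℝ) * y i⌋ - p * k : ℤ) : ℝ) =
        -∑ i, c i * Int.fract ((p : ℝ) * y i) := by
      push_cast
      rw [hk, mul_sum, ← sum_sub_distrib, ← sum_neg_distrib]
      refine sum_congr rfl fun i _ => ?_
      rw [Int.fract]
      ring
    have h2 : |((∑ i, c i * ⌊(p : ℝ) * y i⌋ - p * k : ℤ) : ℝ)| ≤ ((∑ i, |c i| : ℤ) : ℝ) := by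
      rw [h1, abs_neg]
      push_cast
      refine (abs_sum_le_sum_abs _ _).trans (sum_le_sum fun i _ => ?_)
      rw [abs_mul, Int.abs_fract]
      exact mul_le_of_le_one_right (abs_nonneg _) (Int.fract_lt_one _).le
    exact_mod_cast h2
  · push_cast
    simp [hy', cellIndex_coe]

end Circle

section Comparison

open Finset

variable {n : ℕ} {t : Fin n → ℕ}

lemma isLFree_empty {G : Type*} [AddCommGroup G] {t : ℕ} (c : Fin t → ℤ) (ht : 3 ≤ t) :
    IsLFree c (∅ : Set G) :=
  fun ⟨_, hx, _⟩ => hx ⟨0, by lia⟩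

lemma bddAbove_dF (c : ∀ i, Fin (t i) → ℤ) :
    BddAbove {r : ℝ | ∃ A : Set UnitAddCircle, MeasurableSet A ∧ (∀ i, IsLFree (c i) A) ∧
      r = (volume A).toReal} := by
  refine ⟨1, ?_⟩
  rintro r ⟨A, -, -, rfl⟩
  refine ENNReal.toReal_le_of_le_ofReal one_pos.le ?_
  rw [ENNReal.ofReal_one, ← UnitAddCircle.measure_univ]
  exact measure_mono (Set.subset_univ _)

lemma bddAbove_dZ (p : ℕ) [NeZero p] (c : ∀ i, Fin (t i) → ℤ) :
    BddAbove {r : ℝ | ∃ A : Set (ZMod p), (∀ i, IsLFree (c i) A) ∧ r = (Nat.card A : ℝ) / p} := by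
  have hp : (0 : ℝ) < p := by exact_mod_cast Nat.pos_of_ne_zero (NeZero.ne p)
  refine ⟨1, ?_⟩
  rintro r ⟨A, -, rfl⟩
  rw [div_le_one hp]
  have := Finite.card_subtype_le (fun x => x ∈ A)
  rw [Nat.card_zmod] at this
  exact_mod_cast this

lemma card_div_le_dF {p : ℕ} [Fact p.Prime] (c : ∀ i, Fin (t i) → ℤ) (ht : ∀ i, 3 ≤ t i)
    {C : ℕ} {D : ℤ} (hD : (D : ZMod p) ≠ 0)
    (hDC : ∀ i, ∃ d : ℤ, c i ⟨0, by have := ht i; lia⟩ * d = D ∧ |d| * ∑ j, |c i j| ≤ C)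
    {q : ZMod p} (hq : q ≠ 0) {A₃ A₄ : Finset (ZMod p)}
    (hA₃ : ∀ i, IsLFree (c i) (A₃ : Set (ZMod p)))
    (hA₄ : ∀ x ∈ A₄, ∀ j : ℤ, |j| ≤ C → x + q * j ∈ A₃) :
    (#A₄ : ℝ) / p ≤ dF (volume : Measure UnitAddCircle) c := by
  have hqD : q * D ≠ 0 := mul_ne_zero hq hD
  set S : Finset (ZMod p) := {m | q * D * m ∈ A₄} with hS
  have hScard : #S = #A₄ := by
    refine card_bij' (fun m _ => q * D * m) (fun x _ => (q * D)⁻¹ * x) ?_ ?_ ?_ ?_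
    · intro m hm
      exact (mem_filter.1 hm).2
    · intro x hx
      simp only [hS, mem_filter, mem_univ, true_and]
      rwa [mul_inv_cancel_left₀ hqD]
    · intro m _
      exact inv_mul_cancel_left₀ hqD m
    · intro x _
      exact mul_inv_cancel_left₀ hqD x
  refine le_csSup (bddAbove_dF c) ⟨cellIndex p ⁻¹' (S : Set (ZMod p)),
    measurableSet_preimage_cellIndex _, fun i => ?_, by
      rw [volume_real_preimage_cellIndex, hScard]⟩
  rintro ⟨x, hx, hsum⟩
  obtain ⟨e, he, hce⟩ := exists_sum_cellIndex_eq (p := p) (c i) hsum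
  obtain ⟨d, hd, hdC⟩ := hDC i
  set i₀ : Fin (t i) := ⟨0, by have := ht i; lia⟩ with hi₀
  refine hA₃ i ⟨fun k => q * D * cellIndex p (x k) + q * ((if k = i₀ then -(d * e) else 0 : ℤ)),
    fun k => ?_, ?_⟩
  · have h1 := hx k
    simp only [Set.mem_preimage, mem_coe, hS, mem_filter, mem_univ, true_and] at h1
    refine hA₄ _ h1 _ ?_
    split_ifs
    · rw [abs_neg, abs_mul]
      exact (mul_le_mul_of_nonneg_left he (abs_nonneg _)).trans hdC
    · simp
  · have hd' : (c i i₀ : ZMod p) * d = D := by exact_mod_cast congrArg (Int.cast (R := ZMod p)) hd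
    have h1 : ∑ k, (c i k : ZMod p) * (q * ((if k = i₀ then -(d * e) else 0 : ℤ) : ZMod p)) =
        -(q * D * e) := by
      rw [sum_eq_single i₀ (fun k _ hk => by simp [hk]) (by simp)]
      simp only [if_true]
      push_cast
      linear_combination (-(q * e)) * hd'
    simp only [zsmul_eq_mul, mul_add, sum_add_distrib, h1]
    have h2 : ∑ k, (c i k : ZMod p) * (q * D * cellIndex p (x k)) = q * D * e := by
      rw [← hce, mul_sum]
      exact sum_congr rfl fun k _ => by ring
    rw [h2]
    ring

lemma exists_forall_dZ_le (c : ∀ i, Fin (t i) → ℤ) (hc : ∀ i j, c i j ≠ 0) (ht : ∀ i, 3 ≤ t i)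
    {ε : ℝ} (hε : 0 < ε) :
    ∃ N : ℕ, ∀ p : ℕ, p.Prime → N ≤ p →
      dZ p c ≤ dF (volume : Measure UnitAddCircle) c + ε := by
  have ht0 : ∀ i, 0 < t i := fun i => by have := ht i; lia
  set D : ℤ := ∏ i, c i ⟨0, ht0 i⟩ with hD
  have hD0 : D ≠ 0 := prod_ne_zero_iff.2 fun i _ => hc i _
  set M : ℤ := ∑ i, ∑ j, |c i j| with hM
  have hM0 : 0 ≤ M := sum_nonneg fun i _ => sum_nonneg fun j _ => abs_nonneg _
  have hcM : ∀ i, ∑ j, |c i j| ≤ M := fun i =>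
    single_le_sum (f := fun i => ∑ j, |c i j|) (fun i _ => sum_nonneg fun j _ => abs_nonneg _)
      (mem_univ i)
  have hcM' : ∀ i j, |c i j| ≤ M := fun i j =>
    (single_le_sum (f := fun j => |c i j|) (fun _ _ => abs_nonneg _) (mem_univ j)).trans (hcM i)
  set C : ℕ := (|D| * M).toNat with hC
  have hCD : (C : ℤ) = |D| * M := Int.toNat_of_nonneg (mul_nonneg (abs_nonneg _) hM0)
  obtain ⟨N, hN⟩ := exists_structured c ht C hε
  refine ⟨N + M.toNat + D.natAbs + 1, fun p hp hNp => ?_⟩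
  have : Fact p.Prime := ⟨hp⟩
  have hp0 : (0 : ℝ) < p := by exact_mod_cast hp.pos
  have hcast : ∀ z : ℤ, z ≠ 0 → |z| < p → (z : ZMod p) ≠ 0 := by
    intro z hz hzp h
    rw [ZMod.intCast_zmod_eq_zero_iff_dvd] at h
    exact hz (Int.eq_zero_of_abs_lt_dvd h hzp)
  refine csSup_le ⟨_, ∅, fun i => isLFree_empty _ (ht i), rfl⟩ ?_
  rintro r ⟨A, hA, rfl⟩
  classical
  obtain ⟨q, hq, A₃, A₄, hcard, hA₃, hA₄⟩ := hN p (by lia)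
    (fun i j => hcast _ (hc i j) (by have := hcM' i j; lia)) A.toFinset (by simpa using hA)
  have hDp : |D| < p := by
    rw [Int.abs_eq_natAbs]
    exact_mod_cast (by lia : D.natAbs < p)
  have h1 := card_div_le_dF c ht (hcast D hD0 hDp) (fun i => by
    refine ⟨∏ k ∈ univ.erase i, c k ⟨0, ht0 k⟩,
      mul_prod_erase univ (fun k => c k ⟨0, ht0 k⟩) (mem_univ i), ?_⟩
    rw [hCD]
    refine mul_le_mul ?_ (hcM i) (sum_nonneg fun j _ => abs_nonneg _) (abs_nonneg _)
    rw [hD, ← mul_prod_erase univ (fun k => c k ⟨0, ht0 k⟩) (mem_univ i), abs_mul]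
    exact le_mul_of_one_le_left (abs_nonneg _) (Int.one_le_abs (hc i _))) hq hA₃ hA₄
  rw [Nat.card_eq_card_toFinset]
  calc (#A.toFinset : ℝ) / p ≤ (#A₄ + ε * p) / p := by gcongr
    _ = #A₄ / p + ε := by field_simp
    _ ≤ _ := by gcongr

lemma exists_forall_dF_le (c : ∀ i, Fin (t i) → ℤ) (ht : ∀ i, 3 ≤ t i) {ε : ℝ} (hε : 0 < ε) :
    ∃ N : ℕ, ∀ p : ℕ, p.Prime → N ≤ p →
      dF (volume : Measure UnitAddCircle) c ≤ dZ p c + ε := by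
  obtain ⟨r, ⟨A, hAm, hA, rfl⟩, hr⟩ := exists_lt_of_lt_csSup (s := {r : ℝ | ∃ A : Set UnitAddCircle,
      MeasurableSet A ∧ (∀ i, IsLFree (c i) A) ∧ r = (volume A).toReal})
    ⟨_, ∅, MeasurableSet.empty, fun i => isLFree_empty _ (ht i), rfl⟩
    (show dF (volume : Measure UnitAddCircle) c - ε / 2 < _ from sub_lt_self _ (half_pos hε))
  obtain ⟨K, hKA, hK, hAK⟩ := hAm.exists_isCompact_lt_add (measure_ne_top volume A)
    (ε := ENNReal.ofReal (ε / 2)) (by simpa using hε)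
  have hAK' : (volume A).toReal ≤ (volume K).toReal + ε / 2 := by
    have h1 := ENNReal.toReal_mono (by finiteness) hAK.le
    rwa [ENNReal.toReal_add (measure_ne_top volume K) ENNReal.ofReal_ne_top,
      ENNReal.toReal_ofReal (by positivity)] at h1
  have hsep : ∀ i, ∃ s > 0, ∀ x : Fin (t i) → UnitAddCircle, (∀ j, x j ∈ K) →
      s ≤ ‖∑ j, c i j • x j‖ := by
    intro i
    have hcont : Continuous fun x : Fin (t i) → UnitAddCircle => ∑ j, c i j • x j := by fun_prop
    have hcl := ((isCompact_univ_pi fun _ : Fin (t i) => hK).image hcont).isClosed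
    have h0 : (0 : UnitAddCircle) ∈ ((fun x : Fin (t i) → UnitAddCircle => ∑ j, c i j • x j) ''
        Set.univ.pi fun _ => K)ᶜ := by
      rintro ⟨x, hx, hx0⟩
      exact hA i ⟨x, fun j => hKA (hx j trivial), hx0⟩
    obtain ⟨s, hs, hball⟩ := Metric.isOpen_iff.1 hcl.isOpen_compl 0 h0
    refine ⟨s, hs, fun x hx => ?_⟩
    by_contra! h
    exact hball (mem_ball_zero_iff.2 h) ⟨x, fun j _ => hx j, rfl⟩
  choose s hs hsK using hsep
  have hev : ∀ᶠ p : ℕ in Filter.atTop, ∀ i, ((∑ j, |c i j| : ℤ) : ℝ) / p < s i :=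
    Filter.eventually_all.2 fun i =>
      (tendsto_const_div_atTop_nhds_zero_nat _).eventually_lt_const (hs i)
  obtain ⟨N, hN⟩ := Filter.eventually_atTop.1 hev
  refine ⟨N, fun p hp hNp => ?_⟩
  have : Fact p.Prime := ⟨hp⟩
  classical
  set B : Set (ZMod p) := cellIndex p '' K with hB
  have hBfree : ∀ i, IsLFree (c i) B := by
    rintro i ⟨b, hb, hsum⟩
    choose y hyK hyb using hb
    refine absurd (hsK i y hyK) (not_le.2 (lt_of_le_of_lt ?_ (hN p hNp i)))
    have h1 : ∑ j, c i j • ZMod.toAddCircle (cellIndex p (y j)) = 0 := by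
      have := congrArg (ZMod.toAddCircle (N := p)) hsum
      rw [map_sum, map_zero] at this
      simpa only [hyb, map_zsmul] using this
    have h2 : ∑ j, c i j • y j = ∑ j, c i j • (y j - ZMod.toAddCircle (cellIndex p (y j))) := by
      simp only [smul_sub, sum_sub_distrib, h1, sub_zero]
    rw [h2]
    push_cast
    rw [sum_div]
    refine norm_sum_le_of_le _ fun j _ => (norm_zsmul_le _ _).trans ?_
    rw [Int.norm_eq_abs, div_eq_mul_one_div]
    gcongr
    exact norm_sub_toAddCircle_cellIndex_le _
  have h1 : (volume K).toReal ≤ (Nat.card B : ℝ) / p := by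
    rw [Nat.card_eq_card_toFinset, ← volume_real_preimage_cellIndex]
    refine ENNReal.toReal_mono (measure_ne_top volume _) (measure_mono fun x hx => ?_)
    rw [Set.coe_toFinset]
    exact ⟨x, hx, rfl⟩
  have h2 : (Nat.card B : ℝ) / p ≤ dZ p c := le_csSup (bddAbove_dZ p c) ⟨B, hBfree, rfl⟩
  linarith

end Comparison

theorem stmt0 {n : ℕ} {t : Fin n → ℕ} (c : ∀ i, Fin (t i) → ℤ)
    (hc : ∀ i j, c i j ≠ 0) (ht : ∀ i, 3 ≤ t i) :
    ∀ ε : ℝ, 0 < ε → ∃ N : ℕ, ∀ p : ℕ, p.Prime → N ≤ p →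
      |dZ p c - dF (volume : Measure UnitAddCircle) c| ≤ ε := by
  intro ε hε
  obtain ⟨N₁, h₁⟩ := exists_forall_dZ_le c hc ht hε
  obtain ⟨N₂, h₂⟩ := exists_forall_dF_le c ht hε
  refine ⟨max N₁ N₂, fun p hp hN => abs_sub_le_iff.2 ⟨?_, ?_⟩⟩
  · linarith [h₁ p hp ((le_max_left _ _).trans hN)]
  · linarith [h₂ p hp ((le_max_right _ _).trans hN)]

end
end

section
/- Let 𝓕 be a nonempty finite family of non-invariant linear forms. Then d_𝓕(𝕋) ≥ (∑_{L ∈ 𝓕} s_L)^{-1}, where for a form L(x) = c₁x₁ + ⋯ + c_t x_t we write s_L = |c₁| + ⋯ + |c_t|. -/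
open MeasureTheory
noncomputable section

/-- Translating by `x` a closed ball of radius `r` moves the values of a form away from `0` as soon
as the sum of its coefficients sends `x` far enough from `0`. -/
theorem isLFree_closedBall {G : Type*} [SeminormedAddCommGroup G] {t : ℕ} (c : Fin t → ℤ) {x : G}
    {r : ℝ} (hx : (∑ j, |(c j : ℝ)|) * r < ‖(∑ j, c j) • x‖) :
    IsLFree c (Metric.closedBall x r) := by
  rintro ⟨a, ha, h0⟩
  refine hx.not_ge ?_
  have key : (∑ j, c j) • x = ∑ j, c j • (x - a j) := by
    simp only [smul_sub, Finset.sum_sub_distrib, h0, sub_zero, Finset.sum_smul]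
  rw [key, Finset.sum_mul]
  refine (norm_sum_le _ _).trans (Finset.sum_le_sum fun j _ => ?_)
  refine (norm_zsmul_le _ _).trans ?_
  rw [Int.norm_eq_abs]
  gcongr
  rw [← dist_eq_norm, dist_comm]
  exact Metric.mem_closedBall.mp (ha j)

theorem volume_norm_zsmul_le {m : ℤ} (hm : m ≠ 0) (ε : ℝ) :
    volume {x : UnitAddCircle | ‖m • x‖ ≤ ε} ≤ ENNReal.ofReal (2 * ε) := by
  have h : {x : UnitAddCircle | ‖m • x‖ ≤ ε} = (fun x => m • x) ⁻¹' Metric.closedBall 0 ε := by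
    ext x
    simp
  rw [h, (Measure.measurePreserving_zsmul volume hm).measure_preimage
    Metric.isClosed_closedBall.measurableSet.nullMeasurableSet, AddCircle.volume_closedBall]
  exact ENNReal.ofReal_le_ofReal (min_le_right _ _)

theorem toReal_volume_le_dF {n : ℕ} {t : Fin n → ℕ} (c : ∀ i, Fin (t i) → ℤ)
    {A : Set UnitAddCircle} (hA : MeasurableSet A) (hfree : ∀ i, IsLFree (c i) A) :
    (volume A).toReal ≤ dF (volume : Measure UnitAddCircle) c := by
  refine le_csSup ⟨1, ?_⟩ ⟨A, hA, hfree, rfl⟩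
  rintro _ ⟨B, -, -, rfl⟩
  exact ENNReal.toReal_le_of_le_ofReal zero_le_one
    ((measure_mono (Set.subset_univ B)).trans_eq (by simp))

theorem stmt2 {n : ℕ} (hn : 0 < n) {t : Fin n → ℕ} (c : ∀ i, Fin (t i) → ℤ)
    (hc : ∀ i j, c i j ≠ 0) (hinv : ∀ i, ∑ j, c i j ≠ 0) :
    (∑ i, ∑ j, |(c i j : ℝ)|)⁻¹ ≤ dF (volume : Measure UnitAddCircle) c := by
  set S : ℝ := ∑ i, ∑ j, |(c i j : ℝ)| with hS
  have hS1 : 1 ≤ S := by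
    have h : (1 : ℝ) ≤ ∑ j, |(c ⟨0, hn⟩ j : ℝ)| := by
      have := (Int.one_le_abs (hinv ⟨0, hn⟩)).trans (Finset.abs_sum_le_sum_abs _ _)
      exact_mod_cast this
    exact h.trans (Finset.single_le_sum (f := fun i => ∑ j, |(c i j : ℝ)|)
      (fun i _ => Finset.sum_nonneg fun j _ => abs_nonneg _) (Finset.mem_univ _))
  refine le_of_forall_lt_imp_le_of_dense fun δ hδ => ?_
  set r : ℝ := max δ 0 / 2 with hr
  have hr0 : 0 ≤ r := by positivity
  have h2r : 2 * r = max δ 0 := by rw [hr]; ring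
  have hrS : 2 * r < S⁻¹ := by
    rw [h2r]
    exact max_lt hδ (by positivity)
  have hSr : S * (2 * r) < 1 := by
    have hS0 : 0 < S := by linarith
    rwa [← mul_inv_cancel₀ hS0.ne', mul_lt_mul_iff_right₀ hS0]
  obtain ⟨x, hx⟩ : ∃ x : UnitAddCircle, ∀ i,
      (∑ j, |(c i j : ℝ)|) * r < ‖(∑ j, c i j) • x‖ := by
    by_contra! hcover
    have hle : volume (Set.univ : Set UnitAddCircle) ≤ ENNReal.ofReal (S * (2 * r)) := calc
      volume (Set.univ : Set UnitAddCircle)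
        ≤ volume (⋃ i, {x : UnitAddCircle | ‖(∑ j, c i j) • x‖ ≤ (∑ j, |(c i j : ℝ)|) * r}) :=
          measure_mono fun x _ => Set.mem_iUnion.mpr (hcover x)
      _ ≤ ∑ i, ENNReal.ofReal (2 * ((∑ j, |(c i j : ℝ)|) * r)) :=
          (measure_iUnion_fintype_le _ _).trans
            (Finset.sum_le_sum fun i _ => volume_norm_zsmul_le (hinv i) _)
      _ = ENNReal.ofReal (S * (2 * r)) := by
          rw [← ENNReal.ofReal_sum_of_nonneg fun i _ => by positivity, hS, Finset.sum_mul]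
          congr 1
          exact Finset.sum_congr rfl fun i _ => by ring
    rw [UnitAddCircle.measure_univ] at hle
    exact hle.not_gt (by simpa using hSr)
  calc δ ≤ (volume (Metric.closedBall x r)).toReal := by
        rw [AddCircle.volume_closedBall,
          min_eq_right (hrS.le.trans (inv_le_one_of_one_le₀ hS1)), h2r,
          ENNReal.toReal_ofReal (le_max_right _ _)]
        exact le_max_left _ _
    _ ≤ _ := toReal_volume_le_dF c Metric.isClosed_closedBall.measurableSet
        fun i => isLFree_closedBall (c i) (hx i)
end
end

section
/- Let n and k be positive integers and let p ≥ (2k)^n be a prime. Then for any set A ⊆ ℤ/p of size n there is a set B ⊆ ℤ that is Freiman k-isomorphic to A. -/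
theorem Multiset.mul_abs_sum_le_card_mul {m c : ℤ} (hm : 0 ≤ m) (u : Multiset ℤ)
    (h : ∀ x ∈ u, m * |x| ≤ c) : m * |u.sum| ≤ u.card * c := by
  induction u using Multiset.induction_on with
  | empty => simp
  | cons a u ih =>
    have ha := h a (Multiset.mem_cons_self a u)
    have hu := ih fun x hx => h x (Multiset.mem_cons_of_mem hx)
    have := mul_le_mul_of_nonneg_left (abs_add_le a u.sum) hm
    rw [Multiset.sum_cons, Multiset.card_cons]
    push_cast
    linarith

/-- An integer-valued lift of a nonzero dilate, with values small on `A`, is a Freiman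
isomorphism onto its image. -/
theorem isAddFreimanIso_image_of_dilate {k p : ℕ} (hk : 0 < k) (hp : p.Prime)
    {A : Set (ZMod p)} {φ : ZMod p → ℤ} {d : ZMod p} (hd : d ≠ 0)
    (hφ : ∀ a, (φ a : ZMod p) = d * a) (hsmall : ∀ a ∈ A, 2 * k * |φ a| < p) :
    IsAddFreimanIso k A (φ '' A) φ := by
  have := Fact.mk hp
  have hsum (s : Multiset (ZMod p)) : (((s.map φ).sum : ℤ) : ZMod p) = d * s.sum := by
    induction s using Multiset.induction_on with
    | empty => simp
    | cons a s ih => simp [hφ, ih, mul_add]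
  have hbound (s : Multiset (ZMod p)) (hs : ∀ ⦃x⦄, x ∈ s → x ∈ A) (hcard : s.card = k) :
      2 * |(s.map φ).sum| < p := by
    have h := (s.map φ).mul_abs_sum_le_card_mul (m := 2 * k) (c := p - 1) (by positivity) (by
      intro x hx
      obtain ⟨a, ha, rfl⟩ := Multiset.mem_map.1 hx
      have := hsmall a (hs ha)
      lia)
    rw [Multiset.card_map, hcard] at h
    have hk' : (0 : ℤ) < k := by exact_mod_cast hk
    have : 2 * |(s.map φ).sum| ≤ (p : ℤ) - 1 := by
      refine le_of_mul_le_mul_left ?_ hk'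
      linarith
    linarith
  refine ⟨⟨Set.mapsTo_image φ A, fun a _ b _ hab => ?_, Set.surjOn_image φ A⟩,
    fun s t hs ht hs' ht' => ⟨fun h => ?_, fun h => ?_⟩⟩
  · refine mul_left_cancel₀ hd ?_
    rw [← hφ, ← hφ, hab]
  · refine mul_left_cancel₀ hd ?_
    rw [← hsum, ← hsum, h]
  · have hdvd : (p : ℤ) ∣ (s.map φ).sum - (t.map φ).sum := by
      rw [← ZMod.intCast_zmod_eq_zero_iff_dvd]
      push_cast [hsum, h]
      ring
    refine sub_eq_zero.1 (Int.eq_zero_of_abs_lt_dvd hdvd ?_)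
    have h₁ := hbound s hs hs'
    have h₂ := hbound t ht ht'
    have := abs_sub (s.map φ).sum (t.map φ).sum
    linarith

/-- Dirichlet's simultaneous approximation in `ℤ/p`. -/
theorem ZMod.exists_dilate_small {p m : ℕ} [NeZero p] (A : Set (ZMod p)) (hm : 0 < m)
    (h : m ^ Nat.card A < p) :
    ∃ (d : ZMod p) (φ : ZMod p → ℤ), d ≠ 0 ∧ (∀ a, (φ a : ZMod p) = d * a) ∧
      ∀ a ∈ A, m * |φ a| < p := by
  classical
  have hp : 0 < p := NeZero.pos p
  have hbox (x : ZMod p) : x.val * m / p < m :=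
    Nat.div_lt_of_lt_mul (Nat.mul_lt_mul_of_pos_right x.val_lt hm)
  let box (q : ZMod p) (a : A) : Fin m := ⟨(q * a).val * m / p, hbox _⟩
  obtain ⟨q, r, hqr, hEq⟩ := Fintype.exists_ne_map_eq_of_card_lt box (by
    rwa [Fintype.card_fun, Fintype.card_fin, ZMod.card, ← Nat.card_eq_fintype_card])
  refine ⟨q - r, fun a => (q * a).val - (r * a).val, sub_ne_zero.2 hqr, fun a => ?_,
    fun a ha => ?_⟩
  · simp [sub_mul]
  · have h₀ : (q * a).val * m / p = (r * a).val * m / p :=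
      congrArg Fin.val (congrFun hEq ⟨a, ha⟩)
    have h₁ := Nat.div_add_mod ((q * a).val * m) p
    have h₂ := Nat.div_add_mod ((r * a).val * m) p
    have h₃ := Nat.mod_lt ((q * a).val * m) hp
    have h₄ := Nat.mod_lt ((r * a).val * m) hp
    rw [h₀] at h₁
    rw [← abs_of_nonneg (Int.natCast_nonneg m), ← abs_mul, abs_lt]
    zify at h₁ h₂ h₃ h₄
    constructor <;> nlinarith [Int.emod_nonneg (((q * a).val : ℤ) * m) (by lia : (p : ℤ) ≠ 0),
      Int.emod_nonneg (((r * a).val : ℤ) * m) (by lia : (p : ℤ) ≠ 0)]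

/-- ℤ can Freiman (n,k)-model ℤ/p for primes p ≥ (2k)^n. -/
theorem stmt9 (n k : ℕ) (hn : 0 < n) (hk : 0 < k) (p : ℕ) (hp : p.Prime)
    (hpk : (2 * k) ^ n ≤ p) (A : Set (ZMod p)) (hA : Nat.card A = n) :
    ∃ (B : Set ℤ) (φ : ZMod p → ℤ), IsAddFreimanIso k A B φ := by
  have := Fact.mk hp
  rcases Nat.lt_or_ge 1 k with hk₁ | hk₁
  · have hne : (2 * k) ^ n ≠ p := by
      intro h
      have hdvd : 2 * k ∣ p := h ▸ dvd_pow_self _ hn.ne'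
      rcases (Nat.dvd_prime hp).1 hdvd with h | h
      · lia
      · exact Nat.not_prime_mul (by lia) (by lia) (h ▸ hp)
    obtain ⟨d, φ, hd, hφ, hsmall⟩ := ZMod.exists_dilate_small A (m := 2 * k) (by lia)
      (hA ▸ lt_of_le_of_ne hpk hne)
    exact ⟨_, φ, isAddFreimanIso_image_of_dilate hk hp hd hφ (by exact_mod_cast hsmall)⟩
  · obtain rfl : k = 1 := by lia
    have hinj : Function.Injective fun a : ZMod p => (a.val : ℤ) :=
      Nat.cast_injective.comp (ZMod.val_injective p)
    refine ⟨_, _, hinj.injOn.bijOn_image, fun s t _ _ hs ht => ?_⟩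
    obtain ⟨a, rfl⟩ := Multiset.card_eq_one.1 hs
    obtain ⟨b, rfl⟩ := Multiset.card_eq_one.1 ht
    simpa using hinj.eq_iff (a := a) (b := b)
end

section
/- Let n and k be positive integers and let N ≥ (4k)^n be an integer. Then for any set A ⊆ ℤ of size n there is a set B ⊆ ℤ/N that is Freiman k-isomorphic to A. -/
theorem multiset_sum_map_mem_Icc {α : Type*} {f : α → ℤ} {c d : ℤ} {s : Multiset α}
    (hs : ∀ a ∈ s, f a ∈ Set.Icc c d) :
    (s.map f).sum ∈ Set.Icc (s.card * c) (s.card * d) := by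
  constructor
  · simpa using Multiset.card_nsmul_le_sum (s := s.map f) (a := c)
      (by simpa using fun a ha => (hs a ha).1)
  · simpa using Multiset.sum_le_card_nsmul (s.map f) d
      (by simpa using fun a ha => (hs a ha).2)

theorem multiset_sum_map_modEq {α : Type*} {f g : α → ℤ} {p : ℤ}
    (h : ∀ a, f a ≡ g a [ZMOD p]) (s : Multiset α) :
    (s.map f).sum ≡ (s.map g).sum [ZMOD p] := by
  induction s using Multiset.induction with
  | empty => rfl
  | cons a s ih => simpa using (h a).add ih

/-- Dirichlet's simultaneous approximation theorem, for dilates modulo `p`. -/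
theorem exists_small_dilate {α : Type*} (A : Finset α) (f : α → ℤ) {m p : ℕ} (hm : 0 < m)
    (hp : m ^ A.card < p) :
    ∃ (t : ℤ) (g : α → ℤ), t ≠ 0 ∧ |t| < p ∧ (∀ a, g a ≡ t * f a [ZMOD p]) ∧
      ∀ a ∈ A, m * |g a| < p := by
  have hp0 : (0 : ℤ) < p := by exact_mod_cast (Nat.zero_le _).trans_lt hp
  let F : Fin p → A → Finset.Ico (0 : ℤ) m := fun τ a =>
    ⟨m * ((τ : ℤ) * f a % p) / p, by
      have h0 := Int.emod_nonneg ((τ : ℤ) * f a) hp0.ne'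
      have h1 := Int.emod_lt_of_pos ((τ : ℤ) * f a) hp0
      rw [Finset.mem_Ico]
      refine ⟨by positivity, Int.ediv_lt_of_lt_mul hp0 ?_⟩
      have : (0 : ℤ) < m := by exact_mod_cast hm
      nlinarith⟩
  classical
  obtain ⟨τ, σ, hne, hF⟩ := Fintype.exists_ne_map_eq_of_card_lt F (by simpa using hp)
  refine ⟨(τ : ℤ) - σ, fun a => (τ : ℤ) * f a % p - (σ : ℤ) * f a % p, ?_, ?_, ?_, ?_⟩
  · intro h
    apply hne
    ext
    omega
  · rw [abs_lt]
    omega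
  · intro a
    rw [sub_mul]
    exact (Int.mod_modEq _ _).sub (Int.mod_modEq _ _)
  · intro a ha
    have h := congrArg Subtype.val (congrFun hF ⟨a, ha⟩)
    simp only [F] at h
    have h1 := Int.mul_ediv_add_emod (m * ((τ : ℤ) * f a % p)) p
    have h2 := Int.mul_ediv_add_emod (m * ((σ : ℤ) * f a % p)) p
    have h3 := Int.emod_nonneg (m * ((τ : ℤ) * f a % p)) hp0.ne'
    have h4 := Int.emod_nonneg (m * ((σ : ℤ) * f a % p)) hp0.ne'
    have h5 := Int.emod_lt_of_pos (m * ((τ : ℤ) * f a % p)) hp0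
    have h6 := Int.emod_lt_of_pos (m * ((σ : ℤ) * f a % p)) hp0
    rw [h] at h1
    rw [← Nat.abs_cast m, ← abs_mul, abs_lt, mul_sub]
    constructor <;> linarith

/-- A family of integers in an interval of length `L` with `k * L ≥ (4 * k) ^ n` can be replaced by
one in a shorter interval satisfying the same additive relations of order `k`. -/
theorem exists_shorter_model {α : Type*} (A : Finset α) {k : ℕ} (hk : 0 < k) {L : ℕ}
    (hL : (4 * k) ^ A.card ≤ k * L) {f : α → ℤ} {c : ℤ}
    (hf : ∀ a ∈ A, f a ∈ Set.Icc c (c + L)) :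
    ∃ (L' : ℕ) (g : α → ℤ) (d : ℤ), L' < L ∧ (∀ a ∈ A, g a ∈ Set.Icc d (d + L')) ∧
      ∀ s t : Multiset α, (∀ a ∈ s, a ∈ A) → (∀ a ∈ t, a ∈ A) → s.card = k → t.card = k →
        ((s.map g).sum = (t.map g).sum ↔ (s.map f).sum = (t.map f).sum) := by
  have hkL : 0 < k * L := (by positivity : 0 < (4 * k) ^ A.card).trans_le hL
  obtain ⟨p, hp, hp1, hp2⟩ := Nat.exists_prime_lt_and_le_two_mul (k * L) hkL.ne'
  obtain ⟨u, g, hu0, hup, hgu, hg⟩ :=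
    exists_small_dilate A f (by positivity : 0 < 4 * k) (hL.trans_lt hp1)
  have hp1' : (k : ℤ) * L < p := by exact_mod_cast hp1
  have hp2' : (p : ℤ) ≤ 2 * (k * L) := by exact_mod_cast hp2
  have hk' : (0 : ℤ) < k := by exact_mod_cast hk
  have hL0 : 0 < L := Nat.pos_of_mul_pos_left hkL
  have hgL : ∀ a ∈ A, 2 * |g a| < L := by
    intro a ha
    have := hg a ha
    push_cast at this
    nlinarith
  have hgI : ∀ a ∈ A, g a ∈ Set.Icc (-(((L - 1) / 2 : ℕ) : ℤ)) (((L - 1) / 2 : ℕ) : ℤ) := by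
    intro a ha
    rw [Set.mem_Icc, ← abs_le]
    have := hgL a ha
    omega
  refine ⟨L - 1, g, -(((L - 1) / 2 : ℕ) : ℤ), by omega, fun a ha => ?_, ?_⟩
  · have := hgI a ha
    rw [Set.mem_Icc] at this ⊢
    omega
  · intro s t hs ht hsk htk
    have hfs := multiset_sum_map_mem_Icc fun a ha => hf a (hs a ha)
    have hft := multiset_sum_map_mem_Icc fun a ha => hf a (ht a ha)
    have hgs := multiset_sum_map_mem_Icc fun a ha => hgI a (hs a ha)
    have hgt := multiset_sum_map_mem_Icc fun a ha => hgI a (ht a ha)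
    rw [hsk, Set.mem_Icc] at hfs hgs
    rw [htk, Set.mem_Icc] at hft hgt
    have hhalf : 2 * (((L - 1) / 2 : ℕ) : ℤ) ≤ L := by omega
    have hfD : |(s.map f).sum - (t.map f).sum| < p := by
      rw [abs_lt]
      constructor <;> linarith
    have hgD : |(s.map g).sum - (t.map g).sum| < p := by
      rw [abs_lt]
      constructor <;> nlinarith
    have hmod : (s.map g).sum - (t.map g).sum ≡ u * ((s.map f).sum - (t.map f).sum) [ZMOD p] := by
      have hs := multiset_sum_map_modEq hgu s
      have ht := multiset_sum_map_modEq hgu t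
      rw [Multiset.sum_map_mul_left] at hs ht
      rw [mul_sub]
      exact hs.sub ht
    rw [← sub_eq_zero, ← sub_eq_zero (a := (s.map f).sum)]
    constructor
    · intro h
      rw [h] at hmod
      rcases (Nat.prime_iff_prime_int.1 hp).dvd_or_dvd (by simpa using hmod.dvd) with h | h
      · exact absurd (Int.eq_zero_of_abs_lt_dvd h hup) hu0
      · exact Int.eq_zero_of_abs_lt_dvd h hfD
    · intro h
      rw [h, mul_zero] at hmod
      exact Int.eq_zero_of_abs_lt_dvd (Int.modEq_zero_iff_dvd.1 hmod) hgD

theorem exists_zmod_model {α : Type*} (A : Finset α) {k : ℕ} (hk : 0 < k) {N : ℕ}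
    (hN : (4 * k) ^ A.card ≤ N) (L : ℕ) (f : α → ℤ) (c : ℤ)
    (hf : ∀ a ∈ A, f a ∈ Set.Icc c (c + L)) :
    ∃ φ : α → ZMod N,
      ∀ s t : Multiset α, (∀ a ∈ s, a ∈ A) → (∀ a ∈ t, a ∈ A) → s.card = k → t.card = k →
        ((s.map φ).sum = (t.map φ).sum ↔ (s.map f).sum = (t.map f).sum) := by
  induction L using Nat.strong_induction_on generalizing f c with
  | _ L ih =>
  rcases le_or_gt ((4 * k) ^ A.card) (k * L) with hL | hL
  · obtain ⟨L', g, d, hL', hg, hgf⟩ := exists_shorter_model A hk hL hf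
    obtain ⟨φ, hφ⟩ := ih L' hL' g d hg
    exact ⟨φ, fun s t hs ht hsk htk =>
      (hφ s t hs ht hsk htk).trans (hgf s t hs ht hsk htk)⟩
  · refine ⟨fun a => (f a : ZMod N), fun s t hs ht hsk htk => ?_⟩
    have hfs := multiset_sum_map_mem_Icc fun a ha => hf a (hs a ha)
    have hft := multiset_sum_map_mem_Icc fun a ha => hf a (ht a ha)
    rw [hsk, Set.mem_Icc] at hfs
    rw [htk, Set.mem_Icc] at hft
    have hkL : (k : ℤ) * L < N := by exact_mod_cast hL.trans_le hN
    have hcast : ∀ s : Multiset α,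
        (s.map fun a => (f a : ZMod N)).sum = ((s.map f).sum : ℤ) := by
      intro s
      simp [Int.cast_multiset_sum, Multiset.map_map]
    rw [hcast, hcast]
    refine ⟨fun h => ?_, fun h => by rw [h]⟩
    rw [← sub_eq_zero]
    refine Int.eq_zero_of_abs_lt_dvd ((ZMod.intCast_eq_intCast_iff_dvd_sub _ _ _).1 h.symm) ?_
    rw [abs_lt]
    constructor <;> linarith

/-- ℤ/N can Freiman (n,k)-model ℤ for N ≥ (4k)^n. -/
theorem stmt10 (n k : ℕ) (hn : 0 < n) (hk : 0 < k) (N : ℕ)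
    (hNk : (4 * k) ^ n ≤ N) (A : Set ℤ) (hA : Nat.card A = n) :
    ∃ (B : Set (ZMod N)) (φ : ℤ → ZMod N), IsAddFreimanIso k A B φ := by
  have hfin : A.Finite := Set.finite_coe_iff.1 (Nat.finite_of_card_ne_zero (by omega))
  lift A to Finset ℤ using hfin
  have hcard : A.card = n := by simpa using hA
  obtain ⟨c, hc⟩ := A.bddBelow
  obtain ⟨d, hd⟩ := A.bddAbove
  obtain ⟨φ, hφ⟩ := exists_zmod_model A hk (hcard ▸ hNk) (d - c).toNat id c fun a ha => by
    have h1 : c ≤ a := hc ha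
    have h2 : a ≤ d := hd ha
    rw [Set.mem_Icc, id]
    omega
  refine ⟨φ '' A, φ, ?_, fun s t hs ht hsk htk => ?_⟩
  · refine Set.InjOn.bijOn_image fun a ha b hb hab => ?_
    obtain ⟨j, rfl⟩ := Nat.exists_eq_add_of_lt hk
    have h := (hφ (a ::ₘ Multiset.replicate j a) (b ::ₘ Multiset.replicate j a) ?_ ?_
      (by simp) (by simp)).1 (by simp [hab])
    · simpa using h
    · simp only [Multiset.mem_cons, Multiset.mem_replicate]
      rintro x (rfl | ⟨-, rfl⟩) <;> assumption
    · simp only [Multiset.mem_cons, Multiset.mem_replicate]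
      rintro x (rfl | ⟨-, rfl⟩) <;> assumption
  · simpa using hφ s t (fun _ h => hs h) (fun _ h => ht h) hsk htk
end
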